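/- Let m be an odd integer with m ≥ 3 and let G be a non-complete finite simple graph with maximum degree Δ(G) ≥ 3. If n is an integer with (3m+5)/2 ≤ n ≤ 2m, then χ(G^{m/n}) = ω(G^{m/n}). -/

import Mathlib

open SimpleGraph

/-- Representations of vertices of the `n`-subdivision of `G`: `(u, u, 0)` represents the
branch vertex `u`, and for an adjacent pair `(u, v)`, the triple `(u, v, i)` with `i ≤ n`
represents the point at distance `i` from `u` on the path of length `n` replacing the
edge `uv`. -/
def SubdivPre {V : Type*} (G : SimpleGraph V) (n : ℕ) : Type _ :=
  {p : V × V × ℕ // (p.1 = p.2.1 ∧ p.2.2 = 0) ∨ (G.Adj p.1 p.2.1 ∧ p.2.2 ≤ n)}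

/-- The identifications between representations: `(u, v, i)` and `(v, u, n - i)` represent
the same point, and `(u, v, 0)` represents the branch vertex `u`, i.e. `(u, u, 0)`. -/
inductive SubdivRel {V : Type*} (G : SimpleGraph V) (n : ℕ) :
    SubdivPre G n → SubdivPre G n → Prop
  | flip (u v : V) (i : ℕ) (h : G.Adj u v) (hi : i ≤ n) :
      SubdivRel G n ⟨(u, v, i), Or.inr ⟨h, hi⟩⟩
        ⟨(v, u, n - i), Or.inr ⟨h.symm, Nat.sub_le n i⟩⟩
  | collapse (u v : V) (h : G.Adj u v) :
      SubdivRel G n ⟨(u, v, 0), Or.inr ⟨h, Nat.zero_le n⟩⟩ ⟨(u, u, 0), Or.inl ⟨rfl, rfl⟩⟩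

/-- The vertex set of the `n`-subdivision of `G`. -/
def SubdivVert {V : Type*} (G : SimpleGraph V) (n : ℕ) : Type _ := Quot (SubdivRel G n)

/-- The branch vertex of the subdivision corresponding to a vertex `u` of `G`. -/
def branchVertex {V : Type*} (G : SimpleGraph V) (n : ℕ) (u : V) : SubdivVert G n :=
  Quot.mk _ ⟨(u, u, 0), Or.inl ⟨rfl, rfl⟩⟩

/-- The vertex `(uv)_i` of the subdivision: the point at distance `i` from `u` on the
path of length `n` replacing the edge `uv`. -/
def mkVert {V : Type*} (G : SimpleGraph V) (n : ℕ) {u v : V} (h : G.Adj u v)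
    (i : ℕ) (hi : i ≤ n) : SubdivVert G n :=
  Quot.mk _ ⟨(u, v, i), Or.inr ⟨h, hi⟩⟩

/-- The `n`-subdivision `G^{1/n}` of `G`: each edge of `G` is replaced by a path of
length `n`; consecutive points on such a path are adjacent. -/
def subdivision {V : Type*} (G : SimpleGraph V) (n : ℕ) : SimpleGraph (SubdivVert G n) :=
  SimpleGraph.fromRel (fun x y => ∃ (u v : V) (h : G.Adj u v) (i : ℕ) (hi : i < n),
    x = mkVert G n h i (le_of_lt hi) ∧ y = mkVert G n h (i + 1) hi)

/-- The `m`-power of a graph: two distinct vertices are adjacent iff their distance is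
at most `m`, i.e. iff there is a walk of length at most `m` between them. -/
def powerGraph {W : Type*} (H : SimpleGraph W) (m : ℕ) : SimpleGraph W :=
  SimpleGraph.fromRel (fun x y => ∃ w : H.Walk x y, w.length ≤ m)

/-- The fractional power `G^{m/n}`, the `m`-power of the `n`-subdivision of `G`. -/
def fracPower {V : Type*} (G : SimpleGraph V) (m n : ℕ) : SimpleGraph (SubdivVert G n) :=
  powerGraph (subdivision G n) m

def FPbase (k b i : ℕ) : ℕ := if b = 1 then i else k + 1 - i

/-- star for maximum degree three -/
def FPstar (k s h τ : ℕ) (o : ℕ → ℕ) (l i : ℕ) : ℕ × ℕ :=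
  if i = 0 then (3, if h = 1 then 0 else 1)
  else if i = k + 1 then (if τ = 3 then (3, 0) else (τ, FPbase k (o τ) (k - s)))
  else if l = τ ∧ h = 1 ∧ i = k - s then (3, 1)
  else if l = τ ∧ h ≠ 1 ∧ i = 1 then (3, 0)
  else if l = τ ∧ h ≠ 1 ∧ i ≤ k - s then (l, FPbase k (o l) (i - 1))
  else (l, FPbase k (o l) i)

def FPbs (k b i q : ℕ) : Prop := (b = 1 ∧ q = i) ∨ (b ≠ 1 ∧ q + i = k + 1)

lemma FPbs_base (k b i : ℕ) (hi : i ≤ k + 1) : FPbs k b i (FPbase k b i) := by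
  unfold FPbs FPbase; split_ifs <;> omega

def FPspec (k s h τ b l i p q : ℕ) : Prop :=
    (i = 0 ∧ p = 3 ∧ h = 1 ∧ q = 0) ∨ (i = 0 ∧ p = 3 ∧ h ≠ 1 ∧ q = 1) ∨
    (i = k + 1 ∧ τ = 3 ∧ p = 3 ∧ q = 0) ∨
    (i = k + 1 ∧ τ ≠ 3 ∧ p = τ ∧ ((b = 1 ∧ q + s = k) ∨ (b ≠ 1 ∧ q = s + 1))) ∨
    (l = τ ∧ h = 1 ∧ i + s = k ∧ p = 3 ∧ q = 1) ∨
    (l = τ ∧ h ≠ 1 ∧ i = 1 ∧ p = 3 ∧ q = 0) ∨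
    (l = τ ∧ h ≠ 1 ∧ 2 ≤ i ∧ i + s ≤ k ∧ p = l ∧ ((b = 1 ∧ q + 1 = i) ∨ (b ≠ 1 ∧ q + i = k + 2))) ∨
    (1 ≤ i ∧ i ≤ k ∧ (l ≠ τ ∨ h ≠ 1 ∧ k < i + s ∨ h = 1 ∧ i + s ≠ k) ∧
      p = l ∧ ((b = 1 ∧ q = i) ∨ (b ≠ 1 ∧ q + i = k + 1)))

lemma FPstar_spec (k s : ℕ) (hs : s + 2 ≤ k) (h : ℕ) (τ : ℕ) (o : ℕ → ℕ)
    (l i : ℕ) (hi : i ≤ k + 1) (p q : ℕ) (e : FPstar k s h τ o l i = (p, q)) :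
    FPspec k s h τ (o p) l i p q := by
  unfold FPspec
  have B1 := FPbs_base k (o τ) (k-s) (by omega)
  have B2 := FPbs_base k (o l) (i-1) (by omega)
  have B3 := FPbs_base k (o l) i (by omega)
  unfold FPbs at B1 B2 B3
  unfold FPstar at e
  split_ifs at e <;> simp only [Prod.mk.injEq] at e <;> obtain ⟨rfl, rfl⟩ := e
  · exact Or.inl (by omega)
  · exact Or.inr (Or.inl (by omega))
  · exact Or.inr (Or.inr (Or.inl (by omega)))
  · exact Or.inr (Or.inr (Or.inr (Or.inl (by omega))))
  · exact Or.inr (Or.inr (Or.inr (Or.inr (Or.inl (by omega)))))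
  · exact Or.inr (Or.inr (Or.inr (Or.inr (Or.inr (Or.inl (by omega))))))
  · exact Or.inr (Or.inr (Or.inr (Or.inr (Or.inr (Or.inr (Or.inl (by omega)))))))
  · refine Or.inr (Or.inr (Or.inr (Or.inr (Or.inr (Or.inr (Or.inr ⟨by omega, by omega, ?_, rfl, ?_⟩))))))
    · clear B1 B2 B3; omega
    · clear B1 B2; omega

lemma FPstar_S (k s : ℕ) (hs : s + 2 ≤ k) (h : ℕ) (τ : ℕ) (o : ℕ → ℕ)
    (hh : h = 1 → τ ≠ 3) (l l' i i' : ℕ) (hl : l < 3) (hl' : l' < 3) (hi : i ≤ k + 1)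
    (hi' : i' ≤ k + 1) (e : FPstar k s h τ o l i = FPstar k s h τ o l' i') :
    i = i' ∧ (l = l' ∨ i = 0 ∨ i = k + 1) := by
  obtain ⟨p, q, hpq⟩ : ∃ p q, FPstar k s h τ o l i = (p, q) := ⟨_, _, rfl⟩
  have h1 := FPstar_spec k s hs h τ o l i hi p q hpq
  have h2 := FPstar_spec k s hs h τ o l' i' hi' p q (e ▸ hpq)
  clear e hpq
  unfold FPspec at h1 h2
  rcases h1 with h1 | h1 | h1 | h1 | h1 | h1 | h1 | h1 <;>
  rcases h2 with h2 | h2 | h2 | h2 | h2 | h2 | h2 | h2 <;> omega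

lemma FPstar_range (k s : ℕ) (hs : s + 2 ≤ k) (h τ : ℕ) (hτ : τ ≤ 3) (o : ℕ → ℕ)
    (l i : ℕ) (hl : l < 3) (hi : i ≤ k + 1) :
    ((FPstar k s h τ o l i).1 < 3 ∧ 1 ≤ (FPstar k s h τ o l i).2 ∧ (FPstar k s h τ o l i).2 ≤ k) ∨
    ((FPstar k s h τ o l i).1 = 3 ∧ (FPstar k s h τ o l i).2 ≤ 1) := by
  obtain ⟨p, q, hpq⟩ : ∃ p q, FPstar k s h τ o l i = (p, q) := ⟨_, _, rfl⟩
  have h1 := FPstar_spec k s hs h τ o l i hi p q hpq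
  rw [hpq]; unfold FPspec at h1; simp only
  rcases h1 with h1 | h1 | h1 | h1 | h1 | h1 | h1 | h1 <;> omega

lemma FPstar_E_mut (k s : ℕ) (hs : s + 2 ≤ k) (h h' τ τ' : ℕ) (o o' : ℕ → ℕ)
    (hh : h = 1 → τ ≠ 3) (hh' : h' = 1 → τ' ≠ 3) (hhh : ¬ (h = 1 ∧ h' = 1)) (hτ : τ ≠ τ')
    (l i j : ℕ) (hl : l < 3) (hi : i ≤ k + 1) (hj : j ≤ k + 1) (ho : o l = 1 ↔ o' l ≠ 1)
    (e : FPstar k s h τ o l i = FPstar k s h' τ' o' l j) : i + j ≤ k + 2 + s := by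
  obtain ⟨p, q, hpq⟩ : ∃ p q, FPstar k s h τ o l i = (p, q) := ⟨_, _, rfl⟩
  have h1 := FPstar_spec k s hs h τ o l i hi p q hpq
  have h2 := FPstar_spec k s hs h' τ' o' l j hj p q (e ▸ hpq)
  clear e hpq
  unfold FPspec at h1 h2
  by_cases hp : p = l
  · subst hp
    rcases h1 with h1 | h1 | h1 | h1 | h1 | h1 | h1 | h1 <;>
    rcases h2 with h2 | h2 | h2 | h2 | h2 | h2 | h2 | h2 <;> omega
  · rcases h1 with h1 | h1 | h1 | h1 | h1 | h1 | h1 | h1 <;>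
    rcases h2 with h2 | h2 | h2 | h2 | h2 | h2 | h2 | h2 <;> omega

lemma FPstar_E_N (k s : ℕ) (hs : s + 2 ≤ k) (h h' la lb : ℕ) (o o' : ℕ → ℕ)
    (hh : h = 1) (hh' : h' ≠ 1) (hab : la ≠ lb)
    (i j : ℕ) (hla : la < 3) (hlb : lb < 3) (hi : i ≤ k + 1) (hj : j ≤ k + 1)
    (ho : ∀ l < 3, (o l = 1 ↔ o' l ≠ 1))
    (e : FPstar k s h lb o la i = FPstar k s h' 3 o' lb j) : i + j ≤ k + 2 + s := by
  obtain ⟨p, q, hpq⟩ : ∃ p q, FPstar k s h lb o la i = (p, q) := ⟨_, _, rfl⟩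
  have h1 := FPstar_spec k s hs h lb o la i hi p q hpq
  have h2 := FPstar_spec k s hs h' 3 o' lb j hj p q (e ▸ hpq)
  clear e hpq
  unfold FPspec at h1 h2
  have := ho p
  rcases h1 with h1 | h1 | h1 | h1 | h1 | h1 | h1 | h1 <;>
    rcases h2 with h2 | h2 | h2 | h2 | h2 | h2 | h2 | h2 <;> omega

def FPHalf (k s Δ : ℕ) (A : ℕ → ℕ → ℕ × ℕ) (la : ℕ) (t : ℕ → ℕ × ℕ) : Prop :=
  (∀ r ≤ k + s, ∀ i ≤ k + 1, t r = A la i → k + i ≤ r) ∧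
  (∀ r ≤ k + s, ∀ l < Δ, l ≠ la → ∀ j, 1 ≤ j → j ≤ k → t r = A l j → k ≤ j + r)

def FPpal (k Δ : ℕ) (c : ℕ × ℕ) : Prop := (c.1 < Δ ∧ 1 ≤ c.2 ∧ c.2 ≤ k) ∨ (c.1 = Δ ∧ c.2 ≤ 1)

def FPFill (k s Δ : ℕ) (A : ℕ → ℕ → ℕ × ℕ) (la : ℕ) (B : ℕ → ℕ → ℕ × ℕ) (lb : ℕ)
    (t : ℕ → ℕ × ℕ) : Prop :=
  (∀ r ≤ k + s, ∀ r' ≤ k + s, t r = t r' → r = r') ∧ (∀ r ≤ k + s, FPpal k Δ (t r)) ∧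
  FPHalf k s Δ A la t ∧ FPHalf k s Δ B lb (fun r => t (k + s - r))

lemma FPFill.flip {k s Δ : ℕ} {A : ℕ → ℕ → ℕ × ℕ} {la : ℕ} {B : ℕ → ℕ → ℕ × ℕ} {lb : ℕ}
    {t : ℕ → ℕ × ℕ} (h : FPFill k s Δ A la B lb t) :
    FPFill k s Δ B lb A la (fun r => t (k + s - r)) := by
  obtain ⟨h1, h2, h3, h4⟩ := h
  refine ⟨fun r hr r' hr' e => ?_, fun r hr => h2 _ (by omega), h4, ?_⟩
  · have := h1 _ (by omega) _ (by omega) e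
    omega
  · refine ⟨fun r hr i hi e => h3.1 r hr i hi ?_, fun r hr l hl hla j hj hj' e => h3.2 r hr l hl hla j hj hj' ?_⟩
    · rw [← e]; congr 1; omega
    · rw [← e]; congr 1; omega

/-- hypotheses of the filling of a mutual edge -/
structure FPMutHyp (k s hA hB τA τB : ℕ) (oA oB : ℕ → ℕ) (l D D' : ℕ) : Prop where
  hs : s + 2 ≤ k
  h1 : hA = 1 → τA ≠ 3
  h2 : hB = 1 → τB ≠ 3
  h3 : ¬ (hA = 1 ∧ hB = 1)
  h4 : τA ≠ τB
  h5 : l < 3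
  h6 : D < 3
  h7 : D' < 3
  h8 : l ≠ D
  h9 : l ≠ D'
  h10 : D ≠ D'
  h11 : oA l = 1 ↔ oB l ≠ 1
  h12 : τA ≠ D'
  h13 : τB ≠ D
  h14 : τA ≠ D ∨ hA = 1 ∨ (τB = D' ∧ hB ≠ 1 ∧ (oA D = 1 ↔ oB D ≠ 1))

lemma FPspec_mid {k s h τ b l r p q : ℕ} (hs : s + 2 ≤ k) (hr : 2 * r ≤ k + s)
    (g1 : FPspec k s h τ b l (k - r) p q) :
    (l = τ ∧ h = 1 ∧ r = s ∧ p = 3 ∧ q = 1) ∨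
      (l = τ ∧ h ≠ 1 ∧ r + 1 = k ∧ p = 3 ∧ q = 0) ∨
      (l = τ ∧ h ≠ 1 ∧ r + 2 ≤ k ∧ s ≤ r ∧ p = l ∧ ((b = 1 ∧ q + 1 + r = k) ∨ (b ≠ 1 ∧ q = r + 2))) ∨
      ((l ≠ τ ∨ h ≠ 1 ∧ r < s ∨ h = 1 ∧ r ≠ s) ∧
      p = l ∧ ((b = 1 ∧ q + r = k) ∨ (b ≠ 1 ∧ q = r + 1))) := by
  rcases g1 with g1 | g1 | g1 | g1 | g1 | g1 | g1 | g1
  · exfalso; omega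
  · exfalso; omega
  · exfalso; omega
  · exfalso; omega
  · exact Or.inl (by omega)
  · exact Or.inr (Or.inl (by omega))
  · exact Or.inr (Or.inr (Or.inl (by omega)))
  · refine Or.inr (Or.inr (Or.inr ⟨?_, g1.2.2.2.1, ?_⟩))
    · rcases g1.2.2.1 with h | h | h
      · exact Or.inl h
      · exact Or.inr (Or.inl (by omega))
      · exact Or.inr (Or.inr (by omega))
    · have := g1.2.2.2.2
      omega

/-- colour `(3,1)` in a star -/
lemma FPspec_31 {k s h τ b l j : ℕ} (hl : l < 3) (g : FPspec k s h τ b l j 3 1) :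
    (j = 0 ∧ h ≠ 1) ∨ (l = τ ∧ h = 1 ∧ j + s = k) := by
  rcases g with g | g | g | g | g | g | g | g <;> omega

lemma FPspec_30 {k s h τ b l j : ℕ} (hl : l < 3) (g : FPspec k s h τ b l j 3 0) :
    (j = 0 ∧ h = 1) ∨ (j = k + 1 ∧ τ = 3) ∨ (l = τ ∧ h ≠ 1 ∧ j = 1) := by
  rcases g with g | g | g | g | g | g | g | g <;> omega

lemma FPspec_ne {k s h τ b l j p q : ℕ} (hp : p < 3) (hpt : p ≠ τ) (g : FPspec k s h τ b l j p q) :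
    1 ≤ j ∧ j ≤ k ∧ p = l ∧ ((b = 1 ∧ q = j) ∨ (b ≠ 1 ∧ q + j = k + 1)) := by
  rcases g with g | g | g | g | g | g | g | g
  · omega
  · omega
  · omega
  · exact absurd g.2.2.1 hpt
  · omega
  · omega
  · exact absurd (g.2.2.2.2.1.trans g.1) hpt
  · exact ⟨g.1, g.2.1, g.2.2.2⟩

lemma FPMut_AD (k s hA hB τA τB : ℕ) (oA oB : ℕ → ℕ) (l D D' : ℕ)
    (H : FPMutHyp k s hA hB τA τB oA oB l D D') (r l' j : ℕ) (hr : 2 * r ≤ k + s) (hl : l' < 3)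
    (hj : j ≤ k + 1)
    (e : FPstar k s hA τA oA D (k - r) = FPstar k s hB τB oB l' j) :
    (l' = l → j + r ≤ s) ∧ (l' ≠ l → 1 ≤ j → j ≤ k → r ≤ s + j) ∧
      (l' = D' → 2 * (k - j) < k + s → 1 ≤ j → j ≤ k → False) := by
  obtain ⟨hs, h1, h2, h3, h4, h5, h6, h7, h8, h9, h10, h11, h12, h13, h14⟩ := H
  obtain ⟨p, q, hpq⟩ : ∃ p q, FPstar k s hA τA oA D (k - r) = (p, q) := ⟨_, _, rfl⟩
  have g1 := FPspec_mid hs hr (FPstar_spec k s hs hA τA oA D _ (by omega) p q hpq)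
  have g2 := FPstar_spec k s hs hB τB oB l' j hj p q (e ▸ hpq)
  clear e hpq
  rcases g1 with g1 | g1 | g1 | g1
  · obtain ⟨gt, gh, gr, rfl, rfl⟩ := g1
    have := FPspec_31 hl g2
    clear h1 h2 h4 h8 h9 h10 h11 h12 h13 h14 g2
    omega
  · obtain ⟨gt, gh, gr, rfl, rfl⟩ := g1
    have := FPspec_30 hl g2
    clear h1 h2 h4 h11 h12 h13 g2
    omega
  · have hp := g1.2.2.2.2.1
    subst hp
    obtain ⟨a1, a2, rfl, a4⟩ := FPspec_ne h6 (Ne.symm h13) g2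
    clear h1 h2 h4 h11 h12 h13 g2
    omega
  · have hp := g1.2.1
    subst hp
    obtain ⟨a1, a2, rfl, a4⟩ := FPspec_ne h6 (Ne.symm h13) g2
    clear h1 h2 h4 h11 h12 h13 g2 h14 h3
    have g1 := g1.2.2
    omega

lemma FPMut_BD (k s hA hB τA τB : ℕ) (oA oB : ℕ → ℕ) (l D D' : ℕ)
    (H : FPMutHyp k s hA hB τA τB oA oB l D D') (r l' j : ℕ) (hr : 2 * r < k + s) (hl : l' < 3)
    (hj : j ≤ k + 1)
    (e : FPstar k s hB τB oB D' (k - r) = FPstar k s hA τA oA l' j) :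
    (l' = l → j + r ≤ s) ∧ (l' ≠ l → 1 ≤ j → j ≤ k → r ≤ s + j) := by
  obtain ⟨hs, h1, h2, h3, h4, h5, h6, h7, h8, h9, h10, h11, h12, h13, h14⟩ := H
  obtain ⟨p, q, hpq⟩ : ∃ p q, FPstar k s hB τB oB D' (k - r) = (p, q) := ⟨_, _, rfl⟩
  have g1 := FPspec_mid hs hr.le (FPstar_spec k s hs hB τB oB D' _ (by omega) p q hpq)
  have g2 := FPstar_spec k s hs hA τA oA l' j hj p q (e ▸ hpq)
  clear e hpq
  rcases g1 with g1 | g1 | g1 | g1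
  · obtain ⟨gt, gh, gr, rfl, rfl⟩ := g1
    have := FPspec_31 hl g2
    clear h1 h2 h4 h8 h9 h10 h11 h12 h13 h14 g2
    omega
  · obtain ⟨gt, gh, gr, rfl, rfl⟩ := g1
    omega
  · have hp := g1.2.2.2.2.1
    subst hp
    obtain ⟨a1, a2, rfl, a4⟩ := FPspec_ne h7 (Ne.symm h12) g2
    clear h1 h2 h4 h11 h12 h13 g2
    omega
  · have hp := g1.2.1
    subst hp
    obtain ⟨a1, a2, rfl, a4⟩ := FPspec_ne h7 (Ne.symm h12) g2
    clear h1 h2 h4 h11 h12 h13 g2 h14 h3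
    have g1 := g1.2.2
    omega

lemma FPMut_fill (k s hA hB τA τB : ℕ) (oA oB : ℕ → ℕ) (l D D' : ℕ)
    (H : FPMutHyp k s hA hB τA τB oA oB l D D') (hτA : τA ≤ 3) (hτB : τB ≤ 3) :
    ∃ t, FPFill k s 3 (FPstar k s hA τA oA) l (FPstar k s hB τB oB) l t := by
  have hs := H.hs
  have SA := FPstar_S k s hs hA τA oA H.h1
  have SB := FPstar_S k s hs hB τB oB H.h2
  have AD := FPMut_AD k s hA hB τA τB oA oB l D D' H
  have BD := FPMut_BD k s hA hB τA τB oA oB l D D' H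
  have hD := H.h6
  have hD' := H.h7
  have hl := H.h5
  have n1 := H.h8
  have n2 := H.h9
  have n3 := H.h10
  refine ⟨fun r => if 2 * r ≤ k + s then FPstar k s hA τA oA D (k - r)
    else FPstar k s hB τB oB D' (r - s), ?_, ?_, ⟨?_, ?_⟩, ⟨?_, ?_⟩⟩
  · intro r hr r' hr' e
    dsimp only at e
    split_ifs at e with c1 c2 c2
    · have := (SA D D _ _ hD hD (by omega) (by omega) e).1
      omega
    · exfalso
      exact (AD r D' (r' - s) c1 hD' (by omega) e).2.2 rfl (by omega) (by omega) (by omega)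
    · exfalso
      exact (AD r' D' (r - s) c2 hD' (by omega) e.symm).2.2 rfl (by omega) (by omega) (by omega)
    · have := (SB D' D' _ _ hD' hD' (by omega) (by omega) e).1
      omega
  · intro r hr
    dsimp only
    unfold FPpal
    split_ifs
    · exact FPstar_range k s hs hA τA hτA oA D _ hD (by omega)
    · exact FPstar_range k s hs hB τB hτB oB D' _ hD' (by omega)
  · intro r hr i hi e
    dsimp only at e
    split_ifs at e with c1
    · have := SA D l _ _ hD hl (by omega) (by omega) e
      omega
    · have e' : FPstar k s hB τB oB D' (k - (k + s - r)) = FPstar k s hA τA oA l i := by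
        rw [← e]; congr 1; omega
      have := (BD (k + s - r) l i (by omega) hl hi e').1 rfl
      omega
  · intro r hr l' hl' hne j hj hj' e
    dsimp only at e
    split_ifs at e with c1
    · have := SA D l' _ _ hD hl' (by omega) (by omega) e
      omega
    · have e' : FPstar k s hB τB oB D' (k - (k + s - r)) = FPstar k s hA τA oA l' j := by
        rw [← e]; congr 1; omega
      have := (BD (k + s - r) l' j (by omega) hl' (by omega) e').2 hne hj hj'
      omega
  · intro r hr i hi e
    dsimp only at e
    split_ifs at e with c1
    · have := (AD (k + s - r) l i c1 hl hi e).1 rfl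
      omega
    · have := SB D' l _ _ hD' hl (by omega) (by omega) e
      omega
  · intro r hr l' hl' hne j hj hj' e
    dsimp only at e
    split_ifs at e with c1
    · have := (AD (k + s - r) l' j c1 hl' (by omega) e).2.1 hne hj hj'
      omega
    · have := SB D' l' _ _ hD' hl' (by omega) (by omega) e
      omega

/-- the filling of a mutual edge for maximum degree three -/
lemma FPMut_fill_all (k s hA hB τA τB : ℕ) (oA oB : ℕ → ℕ) (l : ℕ) (hs : s + 2 ≤ k)
    (h1 : hA = 1 → τA ≠ 3) (h2 : hB = 1 → τB ≠ 3) (h3 : ¬ (hA = 1 ∧ hB = 1)) (h4 : τA ≠ τB)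
    (h5 : l < 3) (hτA : τA ≤ 3) (hτB : τB ≤ 3) (h11 : oA l = 1 ↔ oB l ≠ 1)
    (h12 : hA ≠ 1 → hB ≠ 1 → τA ≠ 3 → τB ≠ 3 → ∃ d < 3, d ≠ l ∧ (oA d = 1 ↔ oB d ≠ 1)) :
    ∃ t, FPFill k s 3 (FPstar k s hA τA oA) l (FPstar k s hB τB oB) l t := by
  have main : ∀ D D' : ℕ, D < 3 → D' < 3 → l ≠ D → l ≠ D' → D ≠ D' → τA ≠ D' → τB ≠ D →
    ∃ t, FPFill k s 3 (FPstar k s hA τA oA) l (FPstar k s hB τB oB) l t := by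
    intro D D' a1 a2 a3 a4 a5 a6 a7
    have h11' : oB l = 1 ↔ oA l ≠ 1 := by
      clear h12; omega
    by_cases c1 : τA ≠ D ∨ hA = 1
    · exact FPMut_fill k s hA hB τA τB oA oB l D D'
        ⟨hs, h1, h2, h3, h4, h5, a1, a2, a3, a4, a5, h11, a6, a7, c1.elim Or.inl (fun h => Or.inr (Or.inl h))⟩ hτA hτB
    by_cases c2 : τB ≠ D' ∨ hB = 1
    · obtain ⟨t, ht⟩ := FPMut_fill k s hB hA τB τA oB oA l D' D
        ⟨hs, h2, h1, fun h => h3 ⟨h.2, h.1⟩, h4.symm, h5, a2, a1, a4, a3, a5.symm, h11', a7, a6, c2.elim Or.inl (fun h => Or.inr (Or.inl h))⟩ hτB hτA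
      exact ⟨_, ht.flip⟩
    push Not at c1 c2
    obtain ⟨d, hd, hdl, hdo⟩ := h12 c1.2 c2.2 (by rw [c1.1]; exact a1.ne) (by rw [c2.1]; exact a2.ne)
    have : d = D ∨ d = D' := by omega
    rcases this with rfl | rfl
    · exact FPMut_fill k s hA hB τA τB oA oB l d D'
        ⟨hs, h1, h2, h3, h4, h5, a1, a2, a3, a4, a5, h11, a6, a7, Or.inr (Or.inr ⟨c2.1, c2.2, hdo⟩)⟩ hτA hτB
    · have hdo' : oB d = 1 ↔ oA d ≠ 1 := by
        clear h12 h11 h11'; omega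
      obtain ⟨t, ht⟩ := FPMut_fill k s hB hA τB τA oB oA l d D
        ⟨hs, h2, h1, fun h => h3 ⟨h.2, h.1⟩, h4.symm, h5, a2, a1, a4, a3, a5.symm, h11', a7, a6,
          Or.inr (Or.inr ⟨c1.1, c1.2, hdo'⟩)⟩ hτB hτA
      exact ⟨_, ht.flip⟩
  obtain ⟨D, D', a1, a2, a3, a4, a5⟩ : ∃ D D', D < 3 ∧ D' < 3 ∧ l ≠ D ∧ l ≠ D' ∧ D ≠ D' := by
    interval_cases l
    · exact ⟨1, 2, by decide⟩
    · exact ⟨0, 2, by decide⟩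
    · exact ⟨0, 1, by decide⟩
  by_cases c : τA ≠ D' ∧ τB ≠ D
  · exact main D D' a1 a2 a3 a4 a5 c.1 c.2
  · have c' : τA ≠ D ∧ τB ≠ D' := by
      clear h12 main
      omega
    exact main D' D a2 a1 a4 a3 a5.symm c'.1 c'.2

lemma FPN_A {k s lb b l i p q : ℕ} (hb : lb < 3) (g : FPspec k s 1 lb b l i p q) :
    (i = 0 ∧ p = 3 ∧ q = 0) ∨ (i = k + 1 ∧ p = lb ∧ ((b = 1 ∧ q + s = k) ∨ (b ≠ 1 ∧ q = s + 1))) ∨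
    (l = lb ∧ i + s = k ∧ p = 3 ∧ q = 1) ∨
    (1 ≤ i ∧ i ≤ k ∧ p = l ∧ (l ≠ lb ∨ i + s ≠ k) ∧ ((b = 1 ∧ q = i) ∨ (b ≠ 1 ∧ q + i = k + 1))) := by
  rcases g with g | g | g | g | g | g | g | g
  · exact Or.inl (by omega)
  · exfalso; omega
  · exfalso; omega
  · exact Or.inr (Or.inl ⟨g.1, g.2.2⟩)
  · exact Or.inr (Or.inr (Or.inl ⟨g.1, g.2.2⟩))
  · exfalso; omega
  · exfalso; omega
  · exact Or.inr (Or.inr (Or.inr ⟨g.1, g.2.1, g.2.2.2.1, by omega, g.2.2.2.2⟩))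

lemma FPN_B {k s h b l i p q : ℕ} (hh : h ≠ 1) (hl : l < 3) (g : FPspec k s h 3 b l i p q) :
    (i = 0 ∧ p = 3 ∧ q = 1) ∨ (i = k + 1 ∧ p = 3 ∧ q = 0) ∨
    (1 ≤ i ∧ i ≤ k ∧ p = l ∧ ((b = 1 ∧ q = i) ∨ (b ≠ 1 ∧ q + i = k + 1))) := by
  rcases g with g | g | g | g | g | g | g | g
  · exact absurd g.2.2.1 hh
  · exact Or.inl (by omega)
  · exact Or.inr (Or.inl (by omega))
  · exfalso; omega
  · exfalso; omega
  · exfalso; omega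
  · exfalso; omega
  · exact Or.inr (Or.inr ⟨g.1, g.2.1, g.2.2.2⟩)

def FPNt (k s la lb d : ℕ) (A B : ℕ → ℕ → ℕ × ℕ) (r : ℕ) : ℕ × ℕ :=
  if r < (s + 1) / 2 then B lb (r + 1)
  else if k + s < r + s / 2 then A la (k + s - r + 1)
  else if r = s then (3, 1)
  else if r < s then A d (k - (r - (s + 1) / 2))
  else A d (k - (r - (s + 1) / 2 - 1))

lemma FPNt_spec (k s h la lb d : ℕ) (oA oB : ℕ → ℕ) (hs : s + 2 ≤ k) (hh : h ≠ 1)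
    (ha : la < 3) (hb : lb < 3) (hd : d < 3) (hab : la ≠ lb) (had : d ≠ lb)
    (ho : ∀ l < 3, (oA l = 1 ↔ oB l ≠ 1)) (r p q : ℕ) (hr : r ≤ k + s)
    (e : FPNt k s la lb d (FPstar k s 1 lb oA) (FPstar k s h 3 oB) r = (p, q)) :
    (2 * r + 1 ≤ s ∧ p = lb ∧ ((oA p = 1 ∧ q + r = k) ∨ (oA p ≠ 1 ∧ q = r + 1))) ∨
    (k + s < r + s / 2 ∧ p = la ∧ ((oA p = 1 ∧ q = k + s - r + 1) ∨ (oA p ≠ 1 ∧ q + s = r))) ∨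
    (r = s ∧ p = 3 ∧ q = 1) ∨
    (s ≤ 2 * r ∧ r < s ∧ p = d ∧ ((oA p = 1 ∧ q + r = k + (s + 1) / 2) ∨
      (oA p ≠ 1 ∧ q + (s + 1) / 2 = r + 1))) ∨
    (r + s / 2 ≤ k + s ∧ s < r ∧ p = d ∧ ((oA p = 1 ∧ q + r = k + (s + 1) / 2 + 1) ∨
      (oA p ≠ 1 ∧ q + (s + 1) / 2 = r))) := by
  unfold FPNt at e
  split_ifs at e with c1 c2 c3 c4
  · have g := FPN_B hh hb (FPstar_spec k s hs h 3 oB lb (r + 1) (by omega) p q e)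
    rcases g with g | g | g
    · exfalso; omega
    · exfalso; omega
    · have := ho p (by omega)
      exact Or.inl ⟨by omega, g.2.2.1, by omega⟩
  · have g := FPN_A hb (FPstar_spec k s hs 1 lb oA la _ (by omega) p q e)
    rcases g with g | g | g | g
    · exfalso; omega
    · exfalso; omega
    · exfalso; omega
    · have g' := g.2.2.2.2
      exact Or.inr (Or.inl ⟨c2, g.2.2.1, by omega⟩)
  · simp only [Prod.mk.injEq] at e
    exact Or.inr (Or.inr (Or.inl ⟨c3, e.1.symm, e.2.symm⟩))
  · have g := FPN_A hb (FPstar_spec k s hs 1 lb oA d _ (by omega) p q e)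
    rcases g with g | g | g | g
    · exfalso; omega
    · exfalso; omega
    · exfalso; omega
    · have g' := g.2.2.2.2
      exact Or.inr (Or.inr (Or.inr (Or.inl ⟨by omega, c4, g.2.2.1, by omega⟩)))
  · have g := FPN_A hb (FPstar_spec k s hs 1 lb oA d _ (by omega) p q e)
    rcases g with g | g | g | g
    · exfalso; omega
    · exfalso; omega
    · exfalso; omega
    · have g' := g.2.2.2.2
      exact Or.inr (Or.inr (Or.inr (Or.inr ⟨by omega, by omega, g.2.2.1, by omega⟩)))

lemma FPN_fill (k s h la lb d : ℕ) (oA oB : ℕ → ℕ) (hs : s + 2 ≤ k) (hh : h ≠ 1)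
    (ha : la < 3) (hb : lb < 3) (hd : d < 3) (hab : la ≠ lb) (had : d ≠ lb) (hda : d ≠ la)
    (ho : ∀ l < 3, (oA l = 1 ↔ oB l ≠ 1)) :
    FPFill k s 3 (FPstar k s 1 lb oA) la (FPstar k s h 3 oB) lb
      (FPNt k s la lb d (FPstar k s 1 lb oA) (FPstar k s h 3 oB)) := by
  have T := FPNt_spec k s h la lb d oA oB hs hh ha hb hd hab had ho
  set t := FPNt k s la lb d (FPstar k s 1 lb oA) (FPstar k s h 3 oB) with ht
  refine ⟨?_, ?_, ⟨?_, ?_⟩, ⟨?_, ?_⟩⟩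
  · intro r hr r' hr' e
    obtain ⟨p, q, hpq⟩ : ∃ p q, t r = (p, q) := ⟨_, _, rfl⟩
    have g1 := T r p q hr hpq
    have g2 := T r' p q hr' (e ▸ hpq)
    clear T ho
    rcases g1 with g1 | g1 | g1 | g1 | g1 <;> rcases g2 with g2 | g2 | g2 | g2 | g2 <;> omega
  · intro r hr
    obtain ⟨p, q, hpq⟩ : ∃ p q, t r = (p, q) := ⟨_, _, rfl⟩
    have g1 := T r p q hr hpq
    rw [hpq]
    unfold FPpal
    dsimp only
    clear T ho
    rcases g1 with g1 | g1 | g1 | g1 | g1 <;> omega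
  · intro r hr i hi e
    obtain ⟨p, q, hpq⟩ : ∃ p q, t r = (p, q) := ⟨_, _, rfl⟩
    have g1 := T r p q hr hpq
    have g2 := FPN_A hb (FPstar_spec k s hs 1 lb oA la i hi p q (e ▸ hpq))
    clear T ho
    rcases g1 with g1 | g1 | g1 | g1 | g1 <;> rcases g2 with g2 | g2 | g2 | g2 <;> omega
  · intro r hr l hl hla i hi hi' e
    obtain ⟨p, q, hpq⟩ : ∃ p q, t r = (p, q) := ⟨_, _, rfl⟩
    have g1 := T r p q hr hpq
    have g2 := FPN_A hb (FPstar_spec k s hs 1 lb oA l i (by omega) p q (e ▸ hpq))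
    clear T ho
    rcases g1 with g1 | g1 | g1 | g1 | g1 <;> rcases g2 with g2 | g2 | g2 | g2 <;> omega
  · intro r hr i hi e
    dsimp only at e
    obtain ⟨p, q, hpq⟩ : ∃ p q, t (k + s - r) = (p, q) := ⟨_, _, rfl⟩
    have g1 := T (k + s - r) p q (by omega) hpq
    have g2 := FPN_B hh hb (FPstar_spec k s hs h 3 oB lb i hi p q (e ▸ hpq))
    have g3 := ho p
    clear T ho
    rcases g1 with g1 | g1 | g1 | g1 | g1 <;> rcases g2 with g2 | g2 | g2 <;> omega
  · intro r hr l hl hla i hi hi' e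
    dsimp only at e
    obtain ⟨p, q, hpq⟩ : ∃ p q, t (k + s - r) = (p, q) := ⟨_, _, rfl⟩
    have g1 := T (k + s - r) p q (by omega) hpq
    have g2 := FPN_B hh hl (FPstar_spec k s hs h 3 oB l i (by omega) p q (e ▸ hpq))
    have g3 := ho p
    clear T ho
    rcases g1 with g1 | g1 | g1 | g1 | g1 <;> rcases g2 with g2 | g2 | g2 <;> omega

/-- star for maximum degree at least four -/
def FPw (k Δ τ : ℕ) (o : ℕ → ℕ) (l i : ℕ) : ℕ × ℕ :=
  if i = 0 then (Δ, 0)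
  else if i = k + 1 then (τ, 1)
  else if i = 1 then (if l = τ then (Δ, 1) else (l, 1))
  else (l, if o l = 1 then i else k + 2 - i)

lemma FPw_spec {k Δ τ : ℕ} {o : ℕ → ℕ} {l i p q : ℕ} (hk : 2 ≤ k) (hi : i ≤ k + 1)
    (e : FPw k Δ τ o l i = (p, q)) :
    (i = 0 ∧ p = Δ ∧ q = 0) ∨ (i = k + 1 ∧ p = τ ∧ q = 1) ∨ (i = 1 ∧ l = τ ∧ p = Δ ∧ q = 1) ∨
    (i = 1 ∧ l ≠ τ ∧ p = l ∧ q = 1) ∨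
    (2 ≤ i ∧ i ≤ k ∧ p = l ∧ ((o p = 1 ∧ q = i) ∨ (o p ≠ 1 ∧ q + i = k + 2))) := by
  unfold FPw at e
  split_ifs at e with c1 c2 c3 c4 c5 <;> simp only [Prod.mk.injEq] at e <;> obtain ⟨rfl, rfl⟩ := e
  · exact Or.inl ⟨c1, rfl, rfl⟩
  · exact Or.inr (Or.inl ⟨c2, rfl, rfl⟩)
  · exact Or.inr (Or.inr (Or.inl ⟨c3, c4, rfl, rfl⟩))
  · exact Or.inr (Or.inr (Or.inr (Or.inl ⟨c3, c4, rfl, rfl⟩)))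
  · exact Or.inr (Or.inr (Or.inr (Or.inr ⟨by omega, by omega, rfl, by omega⟩)))
  · exact Or.inr (Or.inr (Or.inr (Or.inr ⟨by omega, by omega, rfl, by omega⟩)))

lemma FPw_range {k Δ τ : ℕ} {o : ℕ → ℕ} {l i : ℕ} (hk : 2 ≤ k) (hτ : τ ≤ Δ) (hl : l < Δ)
    (hi : i ≤ k + 1) : FPpal k Δ (FPw k Δ τ o l i) := by
  obtain ⟨p, q, hpq⟩ : ∃ p q, FPw k Δ τ o l i = (p, q) := ⟨_, _, rfl⟩
  have h1 := FPw_spec hk hi hpq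
  rw [hpq]; unfold FPpal; dsimp only
  rcases h1 with h1 | h1 | h1 | h1 | h1 <;> omega

lemma FPw_S {k Δ τ : ℕ} {o : ℕ → ℕ} (hk : 2 ≤ k) (l l' i i' : ℕ) (hl : l < Δ)
    (hl' : l' < Δ) (hi : i ≤ k + 1) (hi' : i' ≤ k + 1) (e : FPw k Δ τ o l i = FPw k Δ τ o l' i') :
    i = i' ∧ (l = l' ∨ i = 0 ∨ i = k + 1) := by
  obtain ⟨p, q, hpq⟩ : ∃ p q, FPw k Δ τ o l i = (p, q) := ⟨_, _, rfl⟩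
  have h1 := FPw_spec hk hi hpq
  have h2 := FPw_spec hk hi' (e ▸ hpq)
  rcases h1 with h1 | h1 | h1 | h1 | h1 <;> rcases h2 with h2 | h2 | h2 | h2 | h2 <;> omega

lemma FPw_E {k s Δ τ τ' : ℕ} {o o' : ℕ → ℕ} (hs : s + 2 ≤ k) (hτ : τ ≠ τ') (la lb i j : ℕ)
    (ho : la = lb → (o la = 1 ↔ o' la ≠ 1)) (hla : la < Δ) (hlb : lb < Δ)
    (hi : i ≤ k + 1) (hj : j ≤ k + 1) (e : FPw k Δ τ o la i = FPw k Δ τ' o' lb j) :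
    i + j ≤ k + 2 + s := by
  obtain ⟨p, q, hpq⟩ : ∃ p q, FPw k Δ τ o la i = (p, q) := ⟨_, _, rfl⟩
  have h1 := FPw_spec (by omega) hi hpq
  have h2 := FPw_spec (by omega) hj (e ▸ hpq)
  rcases h1 with h1 | h1 | h1 | h1 | h1
  · rcases h2 with h2 | h2 | h2 | h2 | h2 <;> omega
  · rcases h2 with h2 | h2 | h2 | h2 | h2 <;> omega
  · rcases h2 with h2 | h2 | h2 | h2 | h2 <;> omega
  · rcases h2 with h2 | h2 | h2 | h2 | h2 <;> omega
  · have hp := h1.2.2.1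
    subst hp
    rcases h2 with h2 | h2 | h2 | h2 | h2 <;> omega

/-- a colour with second coordinate at least two -/
lemma FPw_big {k Δ τ τ' : ℕ} {o o' : ℕ → ℕ} {d u l j : ℕ} (hk : 2 ≤ k) (hu : 2 ≤ u) (hu' : u ≤ k)
    (hd : d < Δ) (hj : j ≤ k + 1) (e : FPw k Δ τ o d u = FPw k Δ τ' o' l j) :
    l = d ∧ (j = u ∨ j + u = k + 2) := by
  obtain ⟨p, q, hpq⟩ : ∃ p q, FPw k Δ τ o d u = (p, q) := ⟨_, _, rfl⟩
  have h1 := FPw_spec (by omega) (by omega) hpq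
  have h2 := FPw_spec (by omega) hj (e ▸ hpq)
  have h3 : p = d ∧ 2 ≤ q ∧ ((o p = 1 ∧ q = u) ∨ (o p ≠ 1 ∧ q + u = k + 2)) := by
    rcases h1 with h1 | h1 | h1 | h1 | h1
    · exfalso; omega
    · exfalso; omega
    · exfalso; omega
    · exfalso; omega
    · exact ⟨h1.2.2.1, by omega, h1.2.2.2⟩
  clear h1
  rcases h2 with h2 | h2 | h2 | h2 | h2 <;> omega

lemma FPw_one {k Δ τ : ℕ} {o : ℕ → ℕ} {ω l j : ℕ} (hk : 2 ≤ k) (hj : j ≤ k + 1)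
    (e : (ω, 1) = FPw k Δ τ o l j) :
    (j = k + 1 ∧ ω = τ) ∨ (j = 1 ∧ ω = if l = τ then Δ else l) := by
  have h2 := FPw_spec hk hj e.symm
  split_ifs <;> rcases h2 with h2 | h2 | h2 | h2 | h2 <;> omega

lemma FPw_half {k s Δ τ τ' : ℕ} {o o' : ℕ → ℕ} (hs : s + 2 ≤ k) (la d d' ω : ℕ)
    (hla : la < Δ) (hd : d < Δ) (hd' : d' < Δ) (h1 : d ≠ la) (h2 : d' ≠ la)
    (hω : ω ≠ τ) (hω' : ω ≠ if la = τ then Δ else la) (t : ℕ → ℕ × ℕ)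
    (ht : ∀ r ≤ k + s, t r = if s + 2 = k ∧ r + 1 = k then (ω, 1) else
      if 2 * r ≤ k + s then FPw k Δ τ o d (k - r) else FPw k Δ τ' o' d' (r - s) ) :
    FPHalf k s Δ (FPw k Δ τ o) la t := by
  refine ⟨?_, ?_⟩
  · intro r hr i hi e
    rw [ht r hr] at e
    split_ifs at e with c1 c2
    · rcases FPw_one (by omega) hi e with h | h
      · exact absurd h.2 hω
      · exact absurd h.2 hω'
    · have := (FPw_big (by omega) (by omega) (by omega) hd hi e).1
      omega
    · have := (FPw_big (by omega) (by omega) (by omega) hd' hi e).1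
      omega
  · intro r hr l hl hla j hj hj' e
    rw [ht r hr] at e
    split_ifs at e with c1 c2
    · omega
    · have := (FPw_S (by omega) _ _ _ _ hd hl (by omega) (by omega) e).1
      omega
    · have := (FPw_big (by omega) (by omega) (by omega) hd' (by omega) e).2
      omega

lemma FPw_half' {k s Δ τ τ' : ℕ} {o o' : ℕ → ℕ} (hs : s + 2 ≤ k) (la d d' ω : ℕ)
    (hla : la < Δ) (hd : d < Δ) (hd' : d' < Δ) (h1 : d ≠ la) (h2 : d' ≠ la)
    (hω : ω ≠ τ) (hω' : ω ≠ if la = τ then Δ else la) (t : ℕ → ℕ × ℕ)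
    (ht : ∀ r ≤ k + s, t r = if s + 2 = k ∧ r + 1 = k then (ω, 1) else
      if 2 * r < k + s then FPw k Δ τ o d (k - r) else FPw k Δ τ' o' d' (r - s) ) :
    FPHalf k s Δ (FPw k Δ τ o) la t := by
  refine ⟨?_, ?_⟩
  · intro r hr i hi e
    rw [ht r hr] at e
    split_ifs at e with c1 c2
    · rcases FPw_one (by omega) hi e with h | h
      · exact absurd h.2 hω
      · exact absurd h.2 hω'
    · have := (FPw_big (by omega) (by omega) (by omega) hd hi e).1
      omega
    · have := (FPw_big (by omega) (by omega) (by omega) hd' hi e).1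
      omega
  · intro r hr l hl hla j hj hj' e
    rw [ht r hr] at e
    split_ifs at e with c1 c2
    · omega
    · have := (FPw_S (by omega) _ _ _ _ hd hl (by omega) (by omega) e).1
      omega
    · have := (FPw_big (by omega) (by omega) (by omega) hd' (by omega) e).2
      omega

lemma FPw_fill (k s Δ τ τ' : ℕ) (o o' : ℕ → ℕ) (hΔ : 4 ≤ Δ) (hs : s + 2 ≤ k) (la lb : ℕ)
    (hla : la < Δ) (hlb : lb < Δ) :
    ∃ t, FPFill k s Δ (FPw k Δ τ o) la (FPw k Δ τ' o') lb t := by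
  obtain ⟨d, hd⟩ : ∃ d, d ∈ Finset.range Δ \ {la, lb} := by
    apply Finset.card_pos.1
    have := Finset.le_card_sdiff {la, lb} (Finset.range Δ)
    have := Finset.card_le_two (a := la) (b := lb)
    rw [Finset.card_range] at *; omega
  obtain ⟨d', hd'⟩ : ∃ d', d' ∈ Finset.range Δ \ {la, lb, d} := by
    apply Finset.card_pos.1
    have := Finset.le_card_sdiff {la, lb, d} (Finset.range Δ)
    have := Finset.card_le_three (a := la) (b := lb) (c := d)
    rw [Finset.card_range] at *; omega
  obtain ⟨ω, hω⟩ : ∃ ω, ω ∈ Finset.range (Δ + 1) \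
      {τ, τ', (if la = τ then Δ else la), (if lb = τ' then Δ else lb)} := by
    apply Finset.card_pos.1
    have := Finset.le_card_sdiff {τ, τ', (if la = τ then Δ else la), (if lb = τ' then Δ else lb)}
      (Finset.range (Δ + 1))
    have := Finset.card_le_four (a := τ) (b := τ') (c := if la = τ then Δ else la)
      (d := if lb = τ' then Δ else lb)
    rw [Finset.card_range] at *; omega
  simp only [Finset.mem_sdiff, Finset.mem_range, Finset.mem_insert, Finset.mem_singleton, not_or] at hd hd' hω
  refine ⟨fun r => if s + 2 = k ∧ r + 1 = k then (ω, 1) else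
      if 2 * r ≤ k + s then FPw k Δ τ o d (k - r) else FPw k Δ τ' o' d' (r - s), ?_, ?_, ?_, ?_⟩
  · intro r hr r' hr' e
    dsimp only at e
    by_cases c1 : s + 2 = k ∧ r + 1 = k <;> by_cases c2 : s + 2 = k ∧ r' + 1 = k
    · omega
    · rw [if_pos c1, if_neg c2] at e
      split_ifs at e with c3
      · have := FPw_one (by omega) (by omega) e
        omega
      · have := FPw_one (by omega) (by omega) e
        omega
    · rw [if_pos c2, if_neg c1] at e
      split_ifs at e with c3
      · have := FPw_one (by omega) (by omega) e.symm
        omega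
      · have := FPw_one (by omega) (by omega) e.symm
        omega
    · rw [if_neg c1, if_neg c2] at e
      split_ifs at e with c3 c4 c4
      · have := (FPw_S (by omega) _ _ _ _ hd.1 hd.1 (by omega) (by omega) e).1
        omega
      · have := (FPw_big (by omega) (by omega) (by omega) hd.1 (by omega) e).1
        exact absurd this hd'.2.2.2
      · have := (FPw_big (by omega) (by omega) (by omega) hd'.1 (by omega) e).1
        exact absurd this.symm hd'.2.2.2
      · have := (FPw_S (by omega) _ _ _ _ hd'.1 hd'.1 (by omega) (by omega) e).1
        omega
  · intro r hr
    dsimp only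
    split_ifs with c1 c2
    · unfold FPpal; dsimp only; omega
    · obtain ⟨p, q, hpq⟩ : ∃ p q, FPw k Δ τ o d (k - r) = (p, q) := ⟨_, _, rfl⟩
      have h1 := FPw_spec (by omega) (by omega) hpq
      rw [hpq]; unfold FPpal; dsimp only
      rcases h1 with h1 | h1 | h1 | h1 | h1 <;> omega
    · obtain ⟨p, q, hpq⟩ : ∃ p q, FPw k Δ τ' o' d' (r - s) = (p, q) := ⟨_, _, rfl⟩
      have h1 := FPw_spec (by omega) (by omega) hpq
      rw [hpq]; unfold FPpal; dsimp only
      rcases h1 with h1 | h1 | h1 | h1 | h1 <;> omega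
  · exact FPw_half hs la d d' ω hla hd.1 hd'.1 hd.2.1 hd'.2.1 hω.2.1 hω.2.2.2.1 _ (fun r hr => rfl)
  · refine FPw_half' (τ' := τ) (o' := o) hs lb d' d ω hlb hd'.1 hd.1 hd'.2.2.1 hd.2.2 hω.2.2.1
      hω.2.2.2.2 _ (fun r hr => ?_)
    dsimp only
    by_cases c1 : s + 2 = k ∧ r + 1 = k
    · rw [if_pos c1, if_pos (by omega)]
    · rw [if_neg c1, if_neg (by omega)]
      by_cases c2 : 2 * r < k + s
      · rw [if_pos c2, if_neg (by omega)]
        congr 1; omega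
      · rw [if_neg c2, if_pos (by omega)]
        congr 1; omega

section FPgeom
variable {V : Type*} {G : SimpleGraph V} {n : ℕ}

lemma FP_mk_flip {u v : V} (h : G.Adj u v) (i : ℕ) (hi : i ≤ n) :
    mkVert G n h i hi = mkVert G n h.symm (n - i) (Nat.sub_le n i) :=
  Quot.sound (SubdivRel.flip u v i h hi)

lemma FP_mk_flip' {u v : V} (h : G.Adj u v) (i j : ℕ) (hi : i ≤ n) (hj : j ≤ n) (hij : i + j = n) :
    mkVert G n h i hi = mkVert G n h.symm j hj := by
  rw [FP_mk_flip]; congr 1; omega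

lemma FP_mk_zero {u v : V} (h : G.Adj u v) :
    mkVert G n h 0 (Nat.zero_le n) = branchVertex G n u :=
  Quot.sound (SubdivRel.collapse u v h)

open Classical in
/-- a normal form of a representation of a vertex of the subdivision -/
noncomputable def FPnormPre (G : SimpleGraph V) (n : ℕ) (p : SubdivPre G n) : V ⊕ Set (V × V × ℕ) :=
  if p.1.2.2 = 0 then Sum.inl p.1.1 else if p.1.2.2 = n then Sum.inl p.1.2.1 else
    Sum.inr {(p.1.1, p.1.2.1, p.1.2.2), (p.1.2.1, p.1.1, n - p.1.2.2)}

noncomputable def FPnorm (G : SimpleGraph V) (n : ℕ) (hn : 0 < n) : SubdivVert G n → V ⊕ Set (V × V × ℕ) :=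
  Quot.lift (FPnormPre G n) (by
    intro a b hab
    cases hab with
    | flip u v i h hi =>
      simp only [FPnormPre]
      by_cases h0 : i = 0
      · subst h0
        simp [hn.ne']
      · by_cases hin : i = n
        · subst hin; simp [h0]
        · have : n - (n - i) = i := by omega
          have h3 : n - i ≠ 0 := by omega
          have h4 : n - i ≠ n := by omega
          simp only [h0, hin, h3, h4, if_false, this]
          rw [Set.pair_comm]
    | collapse u v h => simp [FPnormPre])

lemma FP_mk_eq (hn : 0 < n) {u v a b : V} (h : G.Adj u v) (h' : G.Adj a b) {i j : ℕ} (hi : i ≤ n)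
    (hj : j ≤ n) (e : mkVert G n h i hi = mkVert G n h' j hj) :
    (u = a ∧ v = b ∧ i = j) ∨ (u = b ∧ v = a ∧ i + j = n) ∨ (i = 0 ∧ j = 0 ∧ u = a) ∨
    (i = 0 ∧ j = n ∧ u = b) ∨ (i = n ∧ j = 0 ∧ v = a) ∨ (i = n ∧ j = n ∧ v = b) := by
  have := congrArg (FPnorm G n hn) e
  simp only [FPnorm, mkVert, FPnormPre] at this
  split_ifs at this with c1 c2 c3 c4 c5 c6 c7 c8 c9
  all_goals try simp only [Sum.inl.injEq] at this
  all_goals try (subst this)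
  · simp [c1, c2]
  · simp [c1, c3]
  · simp_all
  · simp_all
  · replace this := Sum.inr.inj this
    have hm : (u, v, i) ∈ ({(a, b, j), (b, a, n - j)} : Set (V × V × ℕ)) := by
      rw [← this]; simp
    simp only [Set.mem_insert_iff, Set.mem_singleton_iff, Prod.mk.injEq] at hm
    rcases hm with hm | hm
    · exact Or.inl hm
    · exact Or.inr (Or.inl ⟨hm.1, hm.2.1, by omega⟩)

lemma FP_adj_cases (hn : 0 < n) {x y : SubdivVert G n} (h : (subdivision G n).Adj x y) :
    ∃ (u v : V) (h : G.Adj u v) (i : ℕ) (hi : i < n),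
    x = mkVert G n h i (le_of_lt hi) ∧ y = mkVert G n h (i + 1) hi := by
  simp only [subdivision, SimpleGraph.fromRel_adj] at h
  rcases h.2 with h | ⟨u, v, huv, i, hi, rfl, rfl⟩
  · exact h
  · exact ⟨v, u, huv.symm, n - (i + 1), by omega, FP_mk_flip' _ _ _ _ _ (by omega), FP_mk_flip' _ _ _ _ _ (by omega)⟩

lemma FP_adj_mk (hn : 0 < n) {x : SubdivVert G n} {a b : V} (hab : G.Adj a b) {p : ℕ} (hp : p ≤ n)
    (h : (subdivision G n).Adj x (mkVert G n hab p hp)) :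
    (∃ (p' : ℕ) (hp' : p' ≤ n), x = mkVert G n hab p' hp' ∧ p' ≤ p + 1 ∧ p ≤ p' + 1) ∨
    (∃ (u : V) (hu : G.Adj a u), p = 0 ∧ x = mkVert G n hu 1 hn) ∨
    (∃ (u : V) (hu : G.Adj b u), p = n ∧ x = mkVert G n hu 1 hn) := by
  obtain ⟨u, v, huv, i, hi, rfl, e⟩ := FP_adj_cases hn h
  have key : i + 1 = n → mkVert G n huv i hi.le = mkVert G n huv.symm 1 hn := fun hh => 
    FP_mk_flip' _ _ _ _ _ hh
  rcases FP_mk_eq hn hab huv hp hi e with ⟨rfl, rfl, h1⟩ | ⟨rfl, rfl, h1⟩ | ⟨h1, h2, rfl⟩ | ⟨h1, h2, rfl⟩ |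
     ⟨h1, h2, rfl⟩ | ⟨h1, h2, rfl⟩
  · exact Or.inl ⟨i, hi.le, rfl, by omega, by omega⟩
  · exact Or.inl ⟨n - i, by omega, FP_mk_flip' _ _ _ _ _ (by omega), by omega, by omega⟩
  · omega
  · exact Or.inr (Or.inl ⟨u, huv.symm, h1, key h2⟩)
  · omega
  · exact Or.inr (Or.inr ⟨u, huv.symm, h1, key h2⟩)

/-- consequences of being at distance at most `r` -/
def FPNear (G : SimpleGraph V) (n r : ℕ) (x y : SubdivVert G n) : Prop :=
  x = y ∨ (∃ (a b : V) (h : G.Adj a b) (p q : ℕ) (hp : p ≤ n) (hq : q ≤ n),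
    x = mkVert G n h p hp ∧ y = mkVert G n h q hq ∧ p ≤ q + r ∧ q ≤ p + r) ∨
  (∃ (a b c : V) (h : G.Adj a b) (h' : G.Adj a c) (p q : ℕ) (hp : p ≤ n) (hq : q ≤ n),
    b ≠ c ∧ x = mkVert G n h p hp ∧ y = mkVert G n h' q hq ∧ p + q ≤ r)

lemma FPNear_corner {r : ℕ} {x y : SubdivVert G n} {a b c : V} (h : G.Adj a b) (h' : G.Adj a c)
    (p q : ℕ) (hp : p ≤ n) (hq : q ≤ n) (hx : x = mkVert G n h p hp) (hy : y = mkVert G n h' q hq)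
    (hpq : p + q ≤ r) : FPNear G n r x y := by
  by_cases hbc : b = c
  · subst hbc
    exact Or.inr (Or.inl ⟨a, b, h, p, q, hp, hq, hx, hy, by omega, by omega⟩)
  · exact Or.inr (Or.inr ⟨a, b, c, h, h', p, q, hp, hq, hbc, hx, hy, hpq⟩)

lemma FP_walk (hn : 0 < n) {x y : SubdivVert G n} (w : (subdivision G n).Walk x y)
    (hw : w.length < n) : FPNear G n w.length x y := by
  induction w with
  | nil => exact Or.inl rfl
  | cons h w ih =>
    rename_i x y z
    rw [Walk.length_cons] at hw
    have ih := ih (by omega)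
    rw [Walk.length_cons]
    rcases ih with rfl | ⟨a, b, hab, p, q, hp, hq, rfl, rfl, h1, h2⟩ |
      ⟨a, b, c, hab, hac, p, q, hp, hq, hbc, rfl, rfl, h1⟩
    · obtain ⟨u, v, huv, i, hi, rfl, rfl⟩ := FP_adj_cases hn h
      exact Or.inr (Or.inl ⟨u, v, huv, i, i + 1, hi.le, hi, rfl, rfl, by omega, by omega⟩)
    · rcases FP_adj_mk hn hab hp h with ⟨p', hp', rfl, h3, h4⟩ | ⟨u, hu, rfl, rfl⟩ | ⟨u, hu, rfl, rfl⟩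
      · exact Or.inr (Or.inl ⟨a, b, hab, p', q, hp', hq, rfl, rfl, by omega, by omega⟩)
      · exact FPNear_corner hu hab 1 q hn hq rfl rfl (by omega)
      · exact FPNear_corner hu hab.symm 1 (p - q) hn (by omega) rfl (FP_mk_flip _ _ _) (by omega)
    · rcases FP_adj_mk hn hab hp h with ⟨p', hp', rfl, h3, h4⟩ | ⟨u, hu, rfl, rfl⟩ | ⟨u, hu, rfl, rfl⟩
      · exact FPNear_corner hab hac p' q hp' hq rfl rfl (by omega)
      · exact FPNear_corner hu hac 1 q hn hq rfl rfl (by omega)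
      · omega

/-- walks along an edge -/
lemma FP_edge_walk {u v : V} (h : G.Adj u v) (i d : ℕ) (hi : i + d ≤ n) :
    ∃ w : (subdivision G n).Walk (mkVert G n h i (by omega)) (mkVert G n h (i + d) hi), w.length ≤ d := by
  induction d with
  | zero => exact ⟨Walk.nil, by simp⟩
  | succ d ih =>
    obtain ⟨w, hw⟩ := ih (by omega)
    by_cases e : mkVert G n h (i + d) (by omega) = mkVert G n h (i + (d + 1)) hi
    · exact ⟨w.copy rfl e, by simp; omega⟩
    · have ha : (subdivision G n).Adj (mkVert G n h (i + d) (by omega)) (mkVert G n h (i + (d + 1)) hi) := by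
        rw [subdivision, SimpleGraph.fromRel_adj]
        exact ⟨e, Or.inl ⟨u, v, h, i + d, by omega, rfl, rfl⟩⟩
      exact ⟨w.append (Walk.cons ha Walk.nil), by simp; omega⟩

lemma FP_walk_zero {u v : V} (h : G.Adj u v) (i : ℕ) (hi : i ≤ n) :
    ∃ w : (subdivision G n).Walk (branchVertex G n u) (mkVert G n h i hi), w.length ≤ i := by
  obtain ⟨w, hw⟩ := FP_edge_walk (n := n) h 0 i (by omega)
  refine ⟨w.copy (FP_mk_zero h) (by congr 1; omega), by simpa using hw⟩

lemma FP_corner_walk {u v v' : V} (h : G.Adj u v) (h' : G.Adj u v') (i j : ℕ) (hi : i ≤ n) (hj : j ≤ n) :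
    ∃ w : (subdivision G n).Walk (mkVert G n h i hi) (mkVert G n h' j hj), w.length ≤ i + j := by
  obtain ⟨w, hw⟩ := FP_walk_zero h i hi
  obtain ⟨w', hw'⟩ := FP_walk_zero h' j hj
  exact ⟨w.reverse.append w', by simp; omega⟩
end FPgeom

section FPcrit
variable {V : Type*} {G : SimpleGraph V}

/-- local data for the colouring -/
structure FPData (G : SimpleGraph V) (k s Δ : ℕ) (A : V → ℕ → ℕ → ℕ × ℕ) (L : V → V → ℕ) : Prop where
  hs : s + 2 ≤ k
  lt : ∀ v w, G.Adj v w → L v w < Δ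
  inj : ∀ v w w', G.Adj v w → G.Adj v w' → L v w = L v w' → w = w'
  S : ∀ v l l' i i', l < Δ → l' < Δ → i ≤ k + 1 → i' ≤ k + 1 → A v l i = A v l' i' →
    i = i' ∧ (l = l' ∨ i = 0 ∨ i = k + 1)
  zero : ∀ v l l', A v l 0 = A v l' 0
  range : ∀ v l i, l < Δ → i ≤ k + 1 → FPpal k Δ (A v l i)
  E : ∀ v w i j, G.Adj v w → i ≤ k + 1 → j ≤ k + 1 → A v (L v w) i = A w (L w v) j → i + j ≤ k + 2 + s
  fill : ∀ v w, G.Adj v w → ∃ t, FPFill k s Δ (A v) (L v w) (A w) (L w v) t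

lemma FPData.symfill {k s Δ : ℕ} {A : V → ℕ → ℕ → ℕ × ℕ} {L : V → V → ℕ}
    (H : FPData G k s Δ A L) (ord : V → ℕ) (hord : Function.Injective ord) :
    ∃ t : V → V → ℕ → ℕ × ℕ, (∀ v w, G.Adj v w → FPFill k s Δ (A v) (L v w) (A w) (L w v) (t v w)) ∧
      ∀ v w, G.Adj v w → ∀ r ≤ k + s, t v w r = t w v (k + s - r) := by
  classical
  have hf := H.fill
  choose! T hT using hf
  refine ⟨fun v w => if ord v < ord w then T v w else fun r => T w v (k + s - r), ?_, ?_⟩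
  · intro v w h
    dsimp only
    split_ifs with c
    · exact hT v w h
    · exact (hT w v h.symm).flip
  · intro v w h r hr
    have hne : ord v ≠ ord w := fun e => h.ne (hord e)
    dsimp only
    by_cases c : ord v < ord w
    · rw [if_pos c, if_neg (by omega)]
      congr 1; omega
    · rw [if_neg c, if_pos (by omega)]

def FPcol (k s : ℕ) (A : V → ℕ → ℕ → ℕ × ℕ) (L : V → V → ℕ) (t : V → V → ℕ → ℕ × ℕ) (v w : V) (i : ℕ) : ℕ × ℕ :=
  if i ≤ k + 1 then A v (L v w) i else if i ≤ 2 * k + 2 + s then t v w (i - k - 2)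
    else A w (L w v) (3 * k + 4 + s - i)

structure FPFull (G : SimpleGraph V) (k s Δ : ℕ) (A : V → ℕ → ℕ → ℕ × ℕ) (L : V → V → ℕ)
    (t : V → V → ℕ → ℕ × ℕ) : Prop extends FPData G k s Δ A L where
  ht : ∀ v w, G.Adj v w → FPFill k s Δ (A v) (L v w) (A w) (L w v) (t v w)
  hsym : ∀ v w, G.Adj v w → ∀ r ≤ k + s, t v w r = t w v (k + s - r)

variable {k s Δ : ℕ} {A : V → ℕ → ℕ → ℕ × ℕ} {L : V → V → ℕ} {t : V → V → ℕ → ℕ × ℕ}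

lemma FPcol_symm (H : FPFull G k s Δ A L t) {v w : V} (h : G.Adj v w) {i : ℕ} (hi : i ≤ 3 * k + 4 + s) :
    FPcol k s A L t v w i = FPcol k s A L t w v (3 * k + 4 + s - i) := by
  have hs := H.hs
  unfold FPcol
  by_cases c1 : i ≤ k + 1
  · rw [if_pos c1, if_neg (by omega), if_neg (by omega)]
    congr 1; omega
  · by_cases c2 : i ≤ 2 * k + 2 + s
    · rw [if_neg c1, if_pos c2, if_neg (by omega), if_pos (by omega), H.hsym v w h _ (by omega)]
      congr 1; omega
    · rw [if_neg c1, if_neg c2, if_pos (by omega)]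

lemma FPcol_pal (H : FPFull G k s Δ A L t) {v w : V} (h : G.Adj v w) {i : ℕ} (hi : i ≤ 3 * k + 4 + s) :
    FPpal k Δ (FPcol k s A L t v w i) := by
  unfold FPcol
  split_ifs with c1 c2
  · exact H.range _ _ _ (H.lt _ _ h) c1
  · exact (H.ht v w h).2.1 _ (by omega)
  · exact H.range _ _ _ (H.lt _ _ h.symm) (by omega)

lemma FPcol_P1a (H : FPFull G k s Δ A L t) {v w : V} (h : G.Adj v w) {i j : ℕ} (hi : i ≤ k + 1)
    (hij : i < j) (hj : j ≤ 3 * k + 4 + s) (hji : j ≤ i + (2 * k + 1)) :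
    FPcol k s A L t v w i ≠ FPcol k s A L t v w j := by
  intro e
  have hs := H.hs
  unfold FPcol at e
  rw [if_pos hi] at e
  split_ifs at e with c1 c2
  · have := (H.S _ _ _ _ _ (H.lt _ _ h) (H.lt _ _ h) hi c1 e).1
    omega
  · have := (H.ht v w h).2.2.1.1 _ (by omega) _ hi e.symm
    omega
  · have := H.E _ _ _ _ h hi (by omega) e
    omega

lemma FPcol_P1 (H : FPFull G k s Δ A L t) {v w : V} (h : G.Adj v w) {i j : ℕ}
    (hij : i < j) (hj : j ≤ 3 * k + 4 + s) (hji : j ≤ i + (2 * k + 1)) :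
    FPcol k s A L t v w i ≠ FPcol k s A L t v w j := by
  by_cases c1 : i ≤ k + 1
  · exact FPcol_P1a H h c1 hij hj hji
  by_cases c2 : j ≤ 2 * k + 2 + s
  · intro e
    unfold FPcol at e
    rw [if_neg c1, if_neg (show ¬ j ≤ k + 1 by omega), if_pos c2, if_pos (show i ≤ 2 * k + 2 + s by omega)] at e
    have := (H.ht v w h).1 _ (by omega) _ (by omega) e
    omega
  · rw [FPcol_symm H h (by omega), FPcol_symm H h hj]
    exact (FPcol_P1a H h.symm (by omega) (by omega) (by omega) (by omega)).symm

lemma FPcol_zero (H : FPFull G k s Δ A L t) (v w : V) : FPcol k s A L t v w 0 = A v 0 0 := by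
  unfold FPcol
  rw [if_pos (by omega)]
  exact H.zero _ _ _

lemma FPcol_P2a (H : FPFull G k s Δ A L t) {v w w' : V} (h : G.Adj v w) (h' : G.Adj v w') (hne : w ≠ w')
    {p q : ℕ} (hpq : p + q ≤ 2 * k + 1) (hqp : q ≤ p) (h0 : p ≠ 0) :
    FPcol k s A L t v w p ≠ FPcol k s A L t v w' q := by
  have hs := H.hs
  by_cases hq : q = 0
  · subst hq
    rw [FPcol_zero H, ← FPcol_zero H v w]
    exact (FPcol_P1 H h (by omega) (by omega) (by omega)).symm
  intro e
  have hL : L v w ≠ L v w' := fun e => hne (H.inj _ _ _ h h' e)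
  unfold FPcol at e
  rw [if_pos (show q ≤ k + 1 by omega)] at e
  by_cases c : p ≤ k + 1
  · rw [if_pos c] at e
    have := H.S _ _ _ _ _ (H.lt _ _ h) (H.lt _ _ h') c (by omega) e
    omega
  · rw [if_neg c, if_pos (by omega)] at e
    have := (H.ht v w h).2.2.1.2 _ (by omega) _ (H.lt _ _ h') hL.symm q (by omega) (by omega) e
    omega

lemma FPcol_P2 (H : FPFull G k s Δ A L t) {v w w' : V} (h : G.Adj v w) (h' : G.Adj v w') (hne : w ≠ w')
    {p q : ℕ} (hpq : p + q ≤ 2 * k + 1) (h0 : ¬ (p = 0 ∧ q = 0)) :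
    FPcol k s A L t v w p ≠ FPcol k s A L t v w' q := by
  rcases le_total q p with c | c
  · exact FPcol_P2a H h h' hne hpq c (by omega)
  · exact (FPcol_P2a H h' h hne.symm (by omega) c (by omega)).symm

open Classical in
noncomputable def FPlift (H : FPFull G k s Δ A L t) : SubdivVert G (3 * k + 4 + s) → ℕ × ℕ :=
  Quot.lift (fun p => if p.1.1 = p.1.2.1 then A p.1.1 0 0 else FPcol k s A L t p.1.1 p.1.2.1 p.1.2.2) (by
    intro a b hab
    cases hab with
    | flip u v i h hi =>
      simp only [h.ne, h.ne.symm, if_false]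
      exact FPcol_symm H h hi
    | collapse u v h =>
      simp only [h.ne, if_false, if_true]
      exact FPcol_zero H _ _)

lemma FPlift_mk (H : FPFull G k s Δ A L t) {u v : V} (h : G.Adj u v) (i : ℕ) (hi : i ≤ 3 * k + 4 + s) :
    FPlift H (mkVert G _ h i hi) = FPcol k s A L t u v i := by
  simp [FPlift, mkVert, h.ne]

lemma FPlift_ne (H : FPFull G k s Δ A L t) {x y : SubdivVert G (3 * k + 4 + s)} (hxy : x ≠ y)
    (w : (subdivision G (3 * k + 4 + s)).Walk x y) (hw : w.length ≤ 2 * k + 1) :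
    FPlift H x ≠ FPlift H y := by
  rcases FP_walk (by omega) w (by omega) with e | ⟨a, b, h, p, q, hp, hq, rfl, rfl, h1, h2⟩ |
    ⟨a, b, c, h, h', p, q, hp, hq, hbc, rfl, rfl, h1⟩
  · exact absurd e hxy
  · rw [FPlift_mk, FPlift_mk]
    rcases lt_trichotomy p q with c | c | c
    · exact FPcol_P1 H h c hq (by omega)
    · subst c; exact absurd rfl hxy
    · exact (FPcol_P1 H h c hp (by omega)).symm
  · rw [FPlift_mk, FPlift_mk]
    refine FPcol_P2 H h h' hbc (by omega) ?_
    rintro ⟨rfl, rfl⟩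
    exact hxy (by rw [FP_mk_zero, FP_mk_zero])

lemma FPlift_pal (H : FPFull G k s Δ A L t) (hΔ : 0 < Δ) (x : SubdivVert G (3 * k + 4 + s)) :
    FPpal k Δ (FPlift H x) := by
  classical
  obtain ⟨⟨⟨u, v, i⟩, hp⟩, rfl⟩ := Quot.exists_rep x
  simp only [FPlift]
  split_ifs with c
  · exact H.range _ _ _ hΔ (by omega)
  · rcases hp with hp | hp
    · exact absurd hp.1 c
    · exact FPcol_pal H hp.1 hp.2

lemma FP_colorable (H : FPData G k s Δ A L) (hΔ : 0 < Δ) (ord : V → ℕ) (hord : Function.Injective ord) :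
    (fracPower G (2 * k + 1) (3 * k + 4 + s)).Colorable (k * Δ + 2) := by
  classical
  obtain ⟨t, ht, hsym⟩ := H.symfill ord hord
  have F : FPFull G k s Δ A L t := { H with ht := ht, hsym := hsym }
  let P : Finset (ℕ × ℕ) := (Finset.range Δ ×ˢ Finset.Icc 1 k) ∪ ({Δ} ×ˢ Finset.range 2)
  have hP : P.card ≤ k * Δ + 2 := by
    refine (Finset.card_union_le _ _).trans ?_
    simp [Finset.card_product, mul_comm]
  have hmem : ∀ x, FPlift F x ∈ P := by
    intro x
    have := FPlift_pal F hΔ x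
    unfold FPpal at this
    simp only [P, Finset.mem_union, Finset.mem_product, Finset.mem_range, Finset.mem_Icc, Finset.mem_singleton]
    omega
  have C : (fracPower G (2 * k + 1) (3 * k + 4 + s)).Coloring P :=
    Coloring.mk (fun x => ⟨FPlift F x, hmem x⟩) (by
      intro x y hxy e
      have e' : FPlift F x = FPlift F y := congrArg Subtype.val e
      simp only [fracPower, powerGraph, SimpleGraph.fromRel_adj] at hxy
      rcases hxy with ⟨hne, ⟨w, hw⟩ | ⟨w, hw⟩⟩
      · exact FPlift_ne F hne w hw e'
      · exact FPlift_ne F hne.symm w hw e'.symm)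
  have := C.colorable
  exact this.mono (by simpa using hP)
end FPcrit

lemma FP_finite {V : Type*} [Finite V] (G : SimpleGraph V) (n : ℕ) : Finite (SubdivVert G n) := by
  have : Finite (SubdivPre G n) := by
    have hinj : Function.Injective (fun p : SubdivPre G n => ((p.1.1, p.1.2.1, (⟨p.1.2.2, by
      rcases p.2 with h | h <;> omega⟩ : Fin (n + 1))) : V × V × Fin (n + 1))) := by
      rintro ⟨⟨a, b, c⟩, h⟩ ⟨⟨a', b', c'⟩, h'⟩ e
      simp only [Prod.mk.injEq, Fin.mk.injEq] at e
      apply Subtype.ext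
      simp [e]
    exact Finite.of_injective _ hinj
  unfold SubdivVert
  infer_instance

lemma FP_clique {V : Type*} [Fintype V] (G : SimpleGraph V) [DecidableRel G.Adj] (k n Δ : ℕ)
    (hΔ : G.maxDegree = Δ) (hΔ3 : 3 ≤ Δ) (hn : 2 * k + 2 < n) :
    k * Δ + 2 ≤ (fracPower G (2 * k + 1) n).cliqueNum := by
  classical
  haveI := FP_finite G n
  haveI : Nonempty V := by
    by_contra hV
    rw [not_nonempty_iff] at hV
    have : G.maxDegree = 0 := by
      simp
    omega
  obtain ⟨v, hv⟩ := G.exists_maximal_degree_vertex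
  rw [hΔ] at hv
  obtain ⟨w0, hw0⟩ : ∃ w, w ∈ G.neighborFinset v := by
    apply Finset.card_pos.1
    rw [card_neighborFinset_eq_degree]; omega
  rw [mem_neighborFinset] at hw0
  -- points as a function on pairs
  let pt : V × ℕ → SubdivVert G n := fun p =>
    if h : G.Adj v p.1 ∧ p.2 ≤ n then mkVert G n h.1 p.2 h.2 else branchVertex G n v
  let I : Finset (V × ℕ) := (G.neighborFinset v ×ˢ Finset.Icc 1 k) ∪ {(w0, 0), (w0, k + 1)}
  have hIcard : I.card = k * Δ + 2 := by
    rw [Finset.card_union_of_disjoint, Finset.card_product, card_neighborFinset_eq_degree, ← hv,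
      Finset.card_pair (by simp)]
    · simp [mul_comm]
    · rw [Finset.disjoint_left]
      rintro ⟨a, b⟩ h1 h2
      simp only [Finset.mem_product, Finset.mem_Icc, Finset.mem_insert, Finset.mem_singleton, Prod.mk.injEq] at h1 h2
      omega
  have hI : ∀ p ∈ I, G.Adj v p.1 ∧ p.2 ≤ k + 1 ∧ (p.2 = 0 ∨ p.2 = k + 1 → p.1 = w0) := by
    rintro ⟨a, b⟩ h
    simp only [I, Finset.mem_union, Finset.mem_product, mem_neighborFinset, Finset.mem_Icc, Finset.mem_insert,
      Finset.mem_singleton, Prod.mk.injEq] at h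
    rcases h with ⟨h1, h2⟩ | ⟨rfl, rfl⟩ | ⟨rfl, rfl⟩
    · exact ⟨h1, by dsimp; omega, fun h => by dsimp at h; omega⟩
    · exact ⟨hw0, by simp, fun _ => rfl⟩
    · exact ⟨hw0, by simp, fun _ => rfl⟩
  have hpt : ∀ p ∈ I, ∃ (h : G.Adj v p.1) (h' : p.2 ≤ n), pt p = mkVert G n h p.2 h' := by
    intro p hp
    have := hI p hp
    have hc : G.Adj v p.1 ∧ p.2 ≤ n := ⟨this.1, by omega⟩
    exact ⟨hc.1, hc.2, by simp only [pt, dif_pos hc]⟩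
  have hinj : Set.InjOn pt I := by
    rintro p hp q hq e
    have h1 := hI p hp
    have h2 := hI q hq
    obtain ⟨a1, b1, e1⟩ := hpt p hp
    obtain ⟨a2, b2, e2⟩ := hpt q hq
    rw [e1, e2] at e
    have := FP_mk_eq (by omega) a1 a2 b1 b2 e
    rcases this with h | h | h | h | h | h
    · exact Prod.ext h.2.1 h.2.2
    · exact absurd h.1 a2.ne
    · refine Prod.ext ?_ (by omega)
      rw [h1.2.2 (Or.inl h.1), h2.2.2 (Or.inl h.2.1)]
    · omega
    · omega
    · omega
  have hcl : (fracPower G (2 * k + 1) n).IsClique ((I.image pt : Finset _) : Set (SubdivVert G n)) := by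
    rw [Finset.coe_image]
    rintro _ ⟨p, hp, rfl⟩ _ ⟨q, hq, rfl⟩ hne
    have h1 := hI p hp
    have h2 := hI q hq
    obtain ⟨a1, b1, e1⟩ := hpt p hp
    obtain ⟨a2, b2, e2⟩ := hpt q hq
    have hs : p.2 + q.2 ≤ 2 * k + 1 := by
      by_contra hc
      have h3 : p.2 = k + 1 := by omega
      have h4 : q.2 = k + 1 := by omega
      apply hne
      congr 1
      exact Prod.ext (by rw [h1.2.2 (Or.inr h3), h2.2.2 (Or.inr h4)]) (by omega)
    simp only [fracPower, powerGraph, SimpleGraph.fromRel_adj]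
    refine ⟨hne, Or.inl ?_⟩
    rw [e1, e2]
    obtain ⟨w, hw⟩ := FP_corner_walk a1 a2 p.2 q.2 b1 b2
    exact ⟨w, by omega⟩
  have := hcl.card_le_cliqueNum
  rw [Finset.card_image_of_injOn hinj, hIcard] at this
  exact this

lemma FP_greedy {V : Type*} [Fintype V] (G : SimpleGraph V) [DecidableRel G.Adj] (D : ℕ)
    (hD : ∀ v, G.degree v ≤ D) (S : Set V) (τ0 : V → ℕ) (h0 : ∀ v ∈ S, τ0 v ≤ D)
    (h1 : ∀ v ∈ S, ∀ w ∈ S, G.Adj v w → τ0 v ≠ τ0 w) :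
    ∃ τ : V → ℕ, (∀ v ∈ S, τ v = τ0 v) ∧ (∀ v, τ v ≤ D) ∧ ∀ v w, G.Adj v w → τ v ≠ τ w := by
  classical
  have key : ∀ U : Finset V, ∃ τ : V → ℕ, (∀ v ∈ S, τ v = τ0 v) ∧ (∀ v, τ v ≤ D) ∧
      ∀ v w, (v ∈ S ∨ v ∈ U) → (w ∈ S ∨ w ∈ U) → G.Adj v w → τ v ≠ τ w := by
    intro U
    induction U using Finset.induction_on with
    | empty =>
      refine ⟨fun v => if v ∈ S then τ0 v else 0, fun v hv => by simp [hv], ?_, ?_⟩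
      · intro v
        dsimp only
        split_ifs with h
        · exact h0 v h
        · omega
      · intro v w hv hw h
        simp only [Finset.notMem_empty, or_false] at hv hw
        simp only [hv, hw, if_true]
        exact h1 v hv w hw h
    | insert a U ha ih =>
      obtain ⟨τ, t1, t2, t3⟩ := ih
      by_cases haS : a ∈ S
      · refine ⟨τ, t1, t2, fun v w hv hw h => t3 v w ?_ ?_ h⟩
        · rcases hv with hv | hv
          · exact Or.inl hv
          · rcases Finset.mem_insert.1 hv with rfl | hv
            · exact Or.inl haS
            · exact Or.inr hv
        · rcases hw with hv | hv
          · exact Or.inl hv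
          · rcases Finset.mem_insert.1 hv with rfl | hv
            · exact Or.inl haS
            · exact Or.inr hv
      · obtain ⟨c, hc⟩ : ∃ c, c ∈ Finset.range (D + 1) \ (G.neighborFinset a).image τ := by
          apply Finset.card_pos.1
          have e1 := Finset.le_card_sdiff ((G.neighborFinset a).image τ) (Finset.range (D + 1))
          have e2 : ((G.neighborFinset a).image τ).card ≤ (G.neighborFinset a).card := Finset.card_image_le
          have e3 := hD a
          rw [card_neighborFinset_eq_degree] at e2
          rw [Finset.card_range] at e1
          omega
        simp only [Finset.mem_sdiff, Finset.mem_range, Finset.mem_image, mem_neighborFinset, not_exists, not_and] at hc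
        refine ⟨Function.update τ a c, ?_, ?_, ?_⟩
        · intro v hv
          rw [Function.update_of_ne (by rintro rfl; exact haS hv)]
          exact t1 v hv
        · intro v
          by_cases hva : v = a
          · subst hva; simp; omega
          · rw [Function.update_of_ne hva]; exact t2 v
        · intro v w hv hw h
          by_cases hva : v = a
          · subst hva
            rw [Function.update_self, Function.update_of_ne h.ne.symm]
            exact fun e => hc.2 w h e.symm
          · by_cases hwa : w = a
            · subst hwa
              rw [Function.update_self, Function.update_of_ne h.ne]
              exact fun e => hc.2 v h.symm e
            · rw [Function.update_of_ne hva, Function.update_of_ne hwa]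
              refine t3 v w ?_ ?_ h
              · simpa [hva] using hv
              · simpa [hwa] using hw
  obtain ⟨τ, t1, t2, t3⟩ := key Finset.univ
  exact ⟨τ, t1, t2, fun v w h => t3 v w (Or.inr (Finset.mem_univ _)) (Or.inr (Finset.mem_univ _)) h⟩

lemma FP_big {V : Type*} [Fintype V] (G : SimpleGraph V) [DecidableRel G.Adj] (k s Δ : ℕ)
    (hD : ∀ v, G.degree v ≤ Δ) (hΔ : 4 ≤ Δ) (hs : s + 2 ≤ k) (ord : V → ℕ) (hord : Function.Injective ord) :
    ∃ A L, FPData G k s Δ A L := by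
  classical
  obtain ⟨τ, -, t2, t3⟩ := FP_greedy G Δ hD ∅ (fun _ => 0) (by simp) (by simp)
  let L : V → V → ℕ := fun v w => if h : w ∈ G.neighborFinset v then ((G.neighborFinset v).equivFin ⟨w, h⟩).val else 0
  have hlt : ∀ v w, G.Adj v w → L v w < Δ := by
    intro v w h
    have h' : w ∈ G.neighborFinset v := by simpa using h
    simp only [L, dif_pos h']
    refine lt_of_lt_of_le (Fin.is_lt _) ?_
    rw [card_neighborFinset_eq_degree]
    exact hD v
  have hinj : ∀ v w w', G.Adj v w → G.Adj v w' → L v w = L v w' → w = w' := by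
    intro v w w' h h' e
    have h1 : w ∈ G.neighborFinset v := by simpa using h
    have h2 : w' ∈ G.neighborFinset v := by simpa using h'
    simp only [L, dif_pos h1, dif_pos h2] at e
    have := (G.neighborFinset v).equivFin.injective (Fin.ext e)
    simpa using this
  let o : V → ℕ → ℕ := fun v l => if ∃ w, G.Adj v w ∧ L v w = l ∧ ord v < ord w then 1 else 0
  have ho : ∀ v w, G.Adj v w → (o v (L v w) = 1 ↔ ord v < ord w) := by
    intro v w h
    simp only [o]
    split_ifs with c
    · obtain ⟨w', h1, h2, h3⟩ := c
      have := hinj v w' w h1 h h2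
      subst this
      simp [h3]
    · simp only [zero_ne_one, false_iff]
      exact fun hlt => c ⟨w, h, rfl, hlt⟩
  refine ⟨fun v => FPw k Δ (τ v) (o v), L, ?_⟩
  refine ⟨hs, hlt, hinj, fun v => FPw_S (by omega), fun v l l' => by simp [FPw], 
    fun v l i hl hi => FPw_range (by omega) (t2 v) hl hi, ?_, ?_⟩
  · intro v w i j h hi hj e
    refine FPw_E hs (t3 v w h) _ _ _ _ ?_ (hlt v w h) (hlt w v h.symm) hi hj e
    intro he
    have h1 := ho v w h
    have h2 := ho w v h.symm
    have h3 : ord v ≠ ord w := fun e => h.ne (hord e)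
    rw [← he] at h2
    rw [h1, Ne, h2]
    omega
  · intro v w h
    exact FPw_fill k s Δ _ _ _ _ hΔ hs _ _ (hlt v w h) (hlt w v h.symm)

lemma FP_conj_zpow {X : Type*} (σ ρ : Equiv.Perm X) (h : σ * ρ * σ⁻¹ = ρ⁻¹) (i : ℤ) :
    σ * ρ ^ i = ρ ^ (-i) * σ := by
  have : σ * ρ ^ i * σ⁻¹ = ρ ^ (-i) := by
    rw [← conj_zpow, h, inv_zpow, zpow_neg]
  rw [← this]; group

lemma FP_two_invol {X : Type*} [Finite X] (σ τ : Equiv.Perm X) (hσ : ∀ x, σ (σ x) = x) (hτ : ∀ x, τ (τ x) = x)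
    (fσ : ∀ x, σ x ≠ x) (fτ : ∀ x, τ x ≠ x) :
    ∃ b : X → Bool, (∀ x, b (σ x) ≠ b x) ∧ (∀ x, b (τ x) ≠ b x) := by
  classical
  set ρ := σ * τ with hρ
  have eσ : σ⁻¹ = σ := by ext x; rw [Equiv.Perm.inv_eq_iff_eq, hσ]
  have eτ : τ⁻¹ = τ := by ext x; rw [Equiv.Perm.inv_eq_iff_eq, hτ]
  have cσ : σ * ρ * σ⁻¹ = ρ⁻¹ := by
    ext x; simp [hρ, eσ, eτ, hσ]
  have cτ : τ * ρ * τ⁻¹ = ρ⁻¹ := by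
    ext x; simp [hρ, eσ, eτ, hτ]
  have kσ := FP_conj_zpow σ ρ cσ
  have kτ := FP_conj_zpow τ ρ cτ
  have main : ∀ x, ¬ ρ.SameCycle x (σ x) := by
    rintro x ⟨j, hj⟩
    rcases Int.even_or_odd' j with ⟨i, rfl | rfl⟩
    · apply fσ ((ρ ^ i) x)
      have e1 : σ ((ρ ^ i) x) = (ρ ^ (-i)) (σ x) := by
        have := congrArg (fun f => f x) (kσ i)
        simpa using this
      rw [e1, ← hj, ← Equiv.Perm.mul_apply, ← zpow_add]
      congr 2; ring
    · apply fτ ((ρ ^ i) x)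
      have e0 : (ρ ^ (2 * i)) x = τ x := by
        rw [show (2 * i + 1) = 1 + 2 * i by ring, zpow_add, zpow_one, Equiv.Perm.mul_apply] at hj
        have h2 : σ (τ ((ρ ^ (2 * i)) x)) = σ x := hj
        have h3 := σ.injective h2
        rw [← h3, hτ, h3]
      have e1 : τ ((ρ ^ i) x) = (ρ ^ (-i)) (τ x) := by
        have := congrArg (fun f => f x) (kτ i)
        simpa using this
      rw [e1, ← e0, ← Equiv.Perm.mul_apply, ← zpow_add]
      congr 2; ring
  have hst : ∀ x, ρ.SameCycle (σ x) (τ x) := by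
    intro x
    refine Equiv.Perm.SameCycle.symm ⟨1, ?_⟩
    simp [hρ, hτ]
  have hst' : ∀ x, ρ.SameCycle x (σ (τ x)) := fun x => ⟨1, by simp [hρ]⟩
  obtain ⟨f, hf⟩ := Countable.exists_injective_nat (Quotient (Equiv.Perm.SameCycle.setoid ρ))
  let cl : X → ℕ := fun x => f (Quotient.mk _ x)
  have hcl : ∀ x y, cl x = cl y ↔ ρ.SameCycle x y := by
    intro x y
    refine ⟨fun h => Quotient.exact (hf h), fun h => congrArg f (Quotient.sound h)⟩
  refine ⟨fun x => decide (cl x < cl (σ x)), fun x => ?_, fun x => ?_⟩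
  · have h1 : cl x ≠ cl (σ x) := fun e => main x ((hcl _ _).1 e)
    dsimp only
    rw [hσ]
    intro e
    rw [decide_eq_decide] at e
    omega
  · have h1 : cl x ≠ cl (σ x) := fun e => main x ((hcl _ _).1 e)
    have h2 := (hcl _ _).2 (hst x)
    have h3 := (hcl _ _).2 (hst' x)
    dsimp only
    rw [← h2, ← h3]
    intro e
    rw [decide_eq_decide] at e
    omega

/-- the partner function of a partial matching -/
lemma FP_partner {V : Type*} (R : V → V → Prop) (hs : ∀ v w, R v w → R w v)
    (hu : ∀ v w w', R v w → R v w' → w = w') :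
    ∃ σ : Equiv.Perm V, (∀ x, σ (σ x) = x) ∧ (∀ v w, R v w → σ v = w) ∧ (∀ v, (∀ w, ¬ R v w) → σ v = v)
      ∧ (∀ v, σ v = v ∨ R v (σ v)) := by
  classical
  let f : V → V := fun v => if h : ∃ w, R v w then h.choose else v
  have hf1 : ∀ v w, R v w → f v = w := by
    intro v w h
    have hex : ∃ w, R v w := ⟨w, h⟩
    simp only [f, dif_pos hex]
    exact hu v _ _ hex.choose_spec h
  have hf2 : ∀ v, (∀ w, ¬ R v w) → f v = v := by
    intro v h
    have : ¬ ∃ w, R v w := fun ⟨w, hw⟩ => h w hw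
    simp only [f, dif_neg this]
  have hi : Function.Involutive f := by
    intro v
    by_cases h : ∃ w, R v w
    · obtain ⟨w, h⟩ := h
      rw [hf1 v w h, hf1 w v (hs _ _ h)]
    · have := hf2 v (fun w hw => h ⟨w, hw⟩)
      rw [this, this]
  refine ⟨hi.toPerm f, fun x => hi x, hf1, hf2, ?_⟩
  intro v
  by_cases h : ∃ w, R v w
  · obtain ⟨w, h⟩ := h
    right
    show R v (f v)
    rw [hf1 v w h]; exact h
  · exact Or.inl (hf2 v (fun w hw => h ⟨w, hw⟩))

lemma FP_two_match {V : Type*} [Finite V] (R S : V → V → Prop) (hRs : ∀ v w, R v w → R w v)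
    (hSs : ∀ v w, S v w → S w v) (hRi : ∀ v, ¬ R v v) (hSi : ∀ v, ¬ S v v)
    (hRu : ∀ v w w', R v w → R v w' → w = w') (hSu : ∀ v w w', S v w → S v w' → w = w') :
    ∃ b : V → Bool, (∀ v w, R v w → b v ≠ b w) ∧ (∀ v w, S v w → b v ≠ b w) := by
  classical
  have aux : ∀ R : V → V → Prop, (∀ v w, R v w → R w v) → (∀ v, ¬ R v v) → 
      (∀ v w w', R v w → R v w' → w = w') → ∃ σ : Equiv.Perm (V × Bool), (∀ x, σ (σ x) = x) ∧ (∀ x, σ x ≠ x) ∧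
        ∀ v w, R v w → σ (v, true) = (w, true) := by
    intro R h1 h2 h3
    let R' : V × Bool → V × Bool → Prop := fun x y => (R x.1 y.1 ∧ x.2 = y.2) ∨
      ((∀ w, ¬ R x.1 w) ∧ x.1 = y.1 ∧ x.2 ≠ y.2)
    obtain ⟨σ, s1, s2, s3, s4⟩ := FP_partner R' (by
      rintro ⟨x, b⟩ ⟨y, c⟩ (h | h)
      · exact Or.inl ⟨h1 _ _ h.1, h.2.symm⟩
      · obtain ⟨h, e, h'⟩ := h
        dsimp only at h e h'
        subst e
        exact Or.inr ⟨h, rfl, h'.symm⟩) (by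
      rintro ⟨x, b⟩ ⟨y, c⟩ ⟨z, d⟩ (⟨h, e⟩ | ⟨h, e, e'⟩) (⟨h', f⟩ | ⟨h', f, f'⟩)
      · exact Prod.ext (h3 _ _ _ h h') (e.symm.trans f)
      · exact absurd h (h' _)
      · exact absurd h' (h _)
      · refine Prod.ext (e.symm.trans f) ?_
        dsimp only at e' f' ⊢
        cases b <;> cases c <;> cases d <;> simp_all)
    refine ⟨σ, s1, ?_, fun v w h => s2 _ _ (Or.inl ⟨h, rfl⟩)⟩
    rintro ⟨x, b⟩ e
    by_cases hx : ∃ w, R x w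
    · obtain ⟨w, hw⟩ := hx
      have := s2 (x, b) (w, b) (Or.inl ⟨hw, rfl⟩)
      rw [e] at this
      have : x = w := congrArg Prod.fst this
      subst this
      exact h2 _ hw
    · have := s2 (x, b) (x, !b) (Or.inr ⟨fun w hw => hx ⟨w, hw⟩, rfl, by simp⟩)
      rw [e] at this
      have := congrArg Prod.snd this
      simp at this
  obtain ⟨σ, a1, a2, a3⟩ := aux R hRs hRi hRu
  obtain ⟨τ, b1, b2, b3⟩ := aux S hSs hSi hSu
  obtain ⟨b, hb, hb'⟩ := FP_two_invol σ τ a1 b1 a2 b2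
  refine ⟨fun v => b (v, true), fun v w h => ?_, fun v w h => ?_⟩
  · have := hb (v, true)
    rw [a3 v w h] at this
    exact this.symm
  · have := hb' (v, true)
    rw [b3 v w h] at this
    exact this.symm

set_option linter.unusedSectionVars false
section FPedge
variable {V : Type*} [Fintype V] {G : SimpleGraph V}

/-- a partial proper edge colouring; an edge is coloured if its value is below 3 -/
structure FPpec (G : SimpleGraph V) (f : V → V → ℕ) : Prop where
  symm : ∀ v w, f v w = f w v
  proper : ∀ v w w', G.Adj v w → G.Adj v w' → f v w < 3 → f v w = f v w' → w = w'

open Classical in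
noncomputable def FPcset (G : SimpleGraph V) (f : V → V → ℕ) : Finset (V × V) :=
  Finset.univ.filter (fun p => G.Adj p.1 p.2 ∧ f p.1 p.2 < 3)

lemma FPcset_mem (f : V → V → ℕ) (v w : V) : (v, w) ∈ FPcset G f ↔ G.Adj v w ∧ f v w < 3 := by
  simp [FPcset]

def FPmax (G : SimpleGraph V) (f : V → V → ℕ) : Prop :=
  FPpec G f ∧ ∀ g, FPpec G g → (FPcset G g).card ≤ (FPcset G f).card

lemma FPmax_exists (G : SimpleGraph V) : ∃ f, FPmax G f := by
  classical
  let S : Set ℕ := {n | ∃ f, FPpec G f ∧ (FPcset G f).card = n}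
  have hne : S.Nonempty := ⟨_, fun _ _ => 3, ⟨fun _ _ => rfl, fun v w w' _ _ h => by omega⟩, rfl⟩
  have hb : BddAbove S := ⟨Fintype.card (V × V), by
    rintro n ⟨f, -, rfl⟩
    exact Finset.card_le_univ _⟩
  obtain ⟨f, hf, e⟩ := Nat.sSup_mem hne hb
  refine ⟨f, hf, fun g hg => ?_⟩
  rw [e]
  exact le_csSup hb ⟨g, hg, rfl⟩

open Classical in
noncomputable def FPset (f : V → V → ℕ) (v w : V) (c : ℕ) : V → V → ℕ :=
  fun x y => if (x = v ∧ y = w) ∨ (x = w ∧ y = v) then c else f x y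

lemma FPset_symm {f : V → V → ℕ} (h : ∀ v w, f v w = f w v) (v w : V) (c : ℕ) (x y : V) :
    FPset f v w c x y = FPset f v w c y x := by
  unfold FPset
  by_cases h1 : (x = v ∧ y = w) ∨ (x = w ∧ y = v)
  · rw [if_pos h1, if_pos (by tauto)]
  · rw [if_neg h1, if_neg (by tauto), h]

lemma FPset_self (f : V → V → ℕ) (v w : V) (c : ℕ) : FPset f v w c v w = c := by
  simp [FPset]

lemma FPset_self' (f : V → V → ℕ) (v w : V) (c : ℕ) : FPset f v w c w v = c := by
  simp [FPset]

lemma FPset_of_ne (f : V → V → ℕ) (v w : V) (c : ℕ) {x y : V} (h : ¬ ((x = v ∧ y = w) ∨ (x = w ∧ y = v))) :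
    FPset f v w c x y = f x y := by
  simp only [FPset, if_neg h]

lemma FPset_pec {f : V → V → ℕ} (H : FPpec G f) {v w : V} (hvw : G.Adj v w) (c : ℕ)
    (h1 : ∀ x, G.Adj v x → c < 3 → x ≠ w → f v x ≠ c) (h2 : ∀ x, G.Adj w x → c < 3 → x ≠ v → f w x ≠ c) :
    FPpec G (FPset f v w c) := by
  refine ⟨FPset_symm H.symm v w c, ?_⟩
  have hne := hvw.ne
  intro x y y' hy hy' hlt e
  by_cases c1 : (x = v ∧ y = w) ∨ (x = w ∧ y = v) <;> by_cases c2 : (x = v ∧ y' = w) ∨ (x = w ∧ y' = v)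
  · rcases c1 with ⟨rfl, rfl⟩ | ⟨rfl, rfl⟩ <;> rcases c2 with ⟨h, rfl⟩ | ⟨h, rfl⟩
    · rfl
    · exact absurd h hne
    · exact absurd h.symm hne
    · rfl
  · rw [FPset_of_ne f v w c c2] at e
    rcases c1 with ⟨rfl, rfl⟩ | ⟨rfl, rfl⟩
    · rw [FPset_self] at e hlt
      by_contra hyy
      exact h1 y' hy' hlt (Ne.symm hyy) e.symm
    · rw [FPset_self'] at e hlt
      by_contra hyy
      exact h2 y' hy' hlt (Ne.symm hyy) e.symm
  · rw [e] at hlt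
    rw [FPset_of_ne f v w c c1] at e
    rcases c2 with ⟨rfl, rfl⟩ | ⟨rfl, rfl⟩
    · rw [FPset_self] at e hlt
      by_contra hyy
      exact h1 y hy hlt hyy e
    · rw [FPset_self'] at e hlt
      by_contra hyy
      exact h2 y hy hlt hyy e
  · rw [FPset_of_ne f v w c c1] at e hlt
    rw [FPset_of_ne f v w c c2] at e
    exact H.proper x y y' hy hy' hlt e

lemma FPset_card {f : V → V → ℕ} (hf : ∀ v w, f v w = f w v) {v w : V} (hvw : G.Adj v w) (c : ℕ) (hc : c < 3)
    (hu : ¬ f v w < 3) : (FPcset G (FPset f v w c)).card = (FPcset G f).card + 2 := by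
  classical
  have : FPcset G (FPset f v w c) = FPcset G f ∪ {(v, w), (w, v)} := by
    ext ⟨x, y⟩
    simp only [FPcset_mem, Finset.mem_union, Finset.mem_insert, Finset.mem_singleton, Prod.mk.injEq]
    by_cases c1 : (x = v ∧ y = w) ∨ (x = w ∧ y = v)
    · rcases c1 with ⟨rfl, rfl⟩ | ⟨rfl, rfl⟩
      · simp [FPset_self, hc, hvw]
      · simp [FPset_self', hc, hvw.symm]
    · rw [FPset_of_ne f v w c c1]; tauto
  rw [this, Finset.card_union_of_disjoint, Finset.card_pair]
  · intro e
    exact hvw.ne (congrArg Prod.fst e)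
  · rw [Finset.disjoint_right]
    rintro ⟨x, y⟩ h1 h2
    simp only [FPcset_mem, Finset.mem_insert, Finset.mem_singleton, Prod.mk.injEq] at h1 h2
    rcases h1 with ⟨rfl, rfl⟩ | ⟨rfl, rfl⟩
    · exact hu h2.2
    · rw [hf] at h2; exact hu h2.2

lemma FP_K0 {f : V → V → ℕ} (H : FPmax G f) {v w : V} (hvw : G.Adj v w) (hu : ¬ f v w < 3) (c : ℕ) (hc : c < 3)
    (h1 : ∀ x, G.Adj v x → f v x ≠ c) (h2 : ∀ x, G.Adj w x → f w x ≠ c) : False := by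
  have := H.2 _ (FPset_pec H.1 hvw c (fun x hx _ _ => h1 x hx) (fun x hx _ _ => h2 x hx))
  rw [FPset_card H.1.symm hvw c hc hu] at this
  omega

lemma FP_missing [DecidableRel G.Adj] {f : V → V → ℕ} (hD : ∀ v, G.degree v ≤ 3) {v w : V} (hvw : G.Adj v w)
    (hu : ¬ f v w < 3) : ∃ c < 3, ∀ x, G.Adj v x → f v x ≠ c := by
  classical
  obtain ⟨c, hc⟩ : ∃ c, c ∈ Finset.range 3 \ ((G.neighborFinset v).erase w).image (f v) := by
    apply Finset.card_pos.1
    have e1 := Finset.le_card_sdiff (((G.neighborFinset v).erase w).image (f v)) (Finset.range 3)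
    have e2 : (((G.neighborFinset v).erase w).image (f v)).card ≤ _ := Finset.card_image_le
    rw [Finset.card_erase_of_mem (by simpa using hvw)] at e2
    have e3 := hD v
    rw [card_neighborFinset_eq_degree] at e2
    rw [Finset.card_range] at e1
    omega
  simp only [Finset.mem_sdiff, Finset.mem_range, Finset.mem_image, Finset.mem_erase, mem_neighborFinset, not_exists, not_and, and_imp] at hc
  refine ⟨c, hc.1, fun x hx e => ?_⟩
  by_cases hxw : x = w
  · subst hxw; omega
  · exact hc.2 x hxw hx e

/-- Kempe chains -/
lemma FP_chain {f : V → V → ℕ} (H : FPpec G f) (β γ : ℕ) (hβ : β < 3) (hγ : γ < 3) (v u1 u2 : V)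
    (hv : ∀ x, G.Adj v x → f v x ≠ β) (h1 : ∀ x, G.Adj u1 x → f u1 x ≠ γ) (h2 : ∀ x, G.Adj u2 x → f u2 x ≠ γ)
    (hne : u1 ≠ u2) : ∃ K : Set V, v ∈ K ∧ (u1 ∉ K ∨ u2 ∉ K) ∧
      ∀ x y, G.Adj x y → (f x y = β ∨ f x y = γ) → x ∈ K → y ∈ K := by
  obtain ⟨σ, s1, s2, s3, -⟩ := FP_partner (fun x y => G.Adj x y ∧ f x y = β)
    (fun x y h => ⟨h.1.symm, by rw [H.symm]; exact h.2⟩)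
    (fun x y y' h h' => H.proper x y y' h.1 h'.1 (by omega) (by omega))
  obtain ⟨τ, t1, t2, t3, -⟩ := FP_partner (fun x y => G.Adj x y ∧ f x y = γ)
    (fun x y h => ⟨h.1.symm, by rw [H.symm]; exact h.2⟩)
    (fun x y y' h h' => H.proper x y y' h.1 h'.1 (by omega) (by omega))
  obtain ⟨ρ, hρ⟩ : ∃ ρ, ρ = σ * τ := ⟨_, rfl⟩
  have eσ : σ⁻¹ = σ := by ext x; rw [Equiv.Perm.inv_eq_iff_eq, s1]
  have eτ : τ⁻¹ = τ := by ext x; rw [Equiv.Perm.inv_eq_iff_eq, t1]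
  have cσ : σ * ρ * σ⁻¹ = ρ⁻¹ := by
    ext x; simp [hρ, eσ, eτ, s1]
  have kσ : ∀ (i : ℤ) x, σ ((ρ ^ i) x) = (ρ ^ (-i)) (σ x) := by
    intro i x
    have := congrArg (fun g => g x) (FP_conj_zpow σ ρ cσ i)
    simpa using this
  have hτ : ∀ x, τ x = σ (ρ x) := by intro x; simp [hρ, s1]
  have fv : σ v = v := s3 v (fun w h => hv w h.1 h.2)
  have kv : ∀ i : ℤ, σ ((ρ ^ i) v) = (ρ ^ (-i)) v := by intro i; rw [kσ, fv]
  have kv' : ∀ i : ℤ, τ ((ρ ^ i) v) = (ρ ^ (-(1 + i))) v := by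
    intro i
    rw [hτ, ← kv, zpow_add, zpow_one, Equiv.Perm.mul_apply]
  have f1 : τ u1 = u1 := t3 u1 (fun w h => h1 w h.1 h.2)
  have f2 : τ u2 = u2 := t3 u2 (fun w h => h2 w h.1 h.2)
  refine ⟨{x | ∃ i : ℤ, (ρ ^ i) v = x}, ⟨0, by simp⟩, ?_, ?_⟩
  · by_contra hcon
    push Not at hcon
    obtain ⟨⟨a, ha⟩, ⟨b, hb⟩⟩ := hcon
    have per : ∀ a : ℤ, ∀ u, (ρ ^ a) v = u → τ u = u → ρ ^ (2 * a + 1) ∈ MulAction.stabilizer (Equiv.Perm V) v := by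
      intro a u ha hu
      rw [MulAction.mem_stabilizer_iff, Equiv.Perm.smul_def]
      rw [← ha, kv'] at hu
      rw [show 2 * a + 1 = (1 + a) + a by ring, zpow_add, Equiv.Perm.mul_apply, ← hu, ← Equiv.Perm.mul_apply, ← zpow_add]
      simp
    have p1 := per a u1 ha f1
    have p2 := per b u2 hb f2
    have p3 : ρ ^ (a - b) ∈ MulAction.stabilizer (Equiv.Perm V) v := by
      have e : ρ ^ (a - b) = (ρ ^ (2 * a + 1)) ^ (a - b - a) * (ρ ^ (2 * b + 1)) ^ a := by
        rw [← zpow_mul, ← zpow_mul, ← zpow_add]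
        congr 1; ring
      rw [e]
      exact mul_mem (zpow_mem p1 _) (zpow_mem p2 _)
    rw [MulAction.mem_stabilizer_iff, Equiv.Perm.smul_def] at p3
    apply hne
    rw [← ha, ← hb, show a = b + (a - b) by ring, zpow_add, Equiv.Perm.mul_apply, p3]
  · rintro x y hxy (e | e) ⟨i, rfl⟩
    · exact ⟨-i, by rw [← kv]; exact s2 _ _ ⟨hxy, e⟩⟩
    · exact ⟨-(1 + i), by rw [← kv']; exact t2 _ _ ⟨hxy, e⟩⟩

end FPedge

set_option linter.unusedSectionVars false
section FPedge2
variable {V : Type*} [Fintype V] {G : SimpleGraph V}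

open Classical in
noncomputable def FPswap (f : V → V → ℕ) (K : Set V) (β γ : ℕ) : V → V → ℕ :=
  fun x y => if x ∈ K ∧ y ∈ K then Equiv.swap β γ (f x y) else f x y

lemma FPswap_in {f : V → V → ℕ} (H : FPpec G f) {K : Set V} {β γ : ℕ}
    (hK : ∀ x y, G.Adj x y → (f x y = β ∨ f x y = γ) → x ∈ K → y ∈ K) {x y : V} (h : G.Adj x y) (hx : x ∈ K) :
    FPswap f K β γ x y = Equiv.swap β γ (f x y) := by
  unfold FPswap
  by_cases hy : y ∈ K
  · rw [if_pos ⟨hx, hy⟩]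
  · rw [if_neg (fun h => hy h.2)]
    rw [Equiv.swap_apply_of_ne_of_ne]
    · exact fun e => hy (hK x y h (Or.inl e) hx)
    · exact fun e => hy (hK x y h (Or.inr e) hx)

lemma FPswap_out {f : V → V → ℕ} {K : Set V} {β γ : ℕ} {x y : V} (hx : x ∉ K) :
    FPswap f K β γ x y = f x y := by
  unfold FPswap
  rw [if_neg (fun h => hx h.1)]

lemma FP_swap_lt {β γ c : ℕ} (hβ : β < 3) (hγ : γ < 3) : Equiv.swap β γ c < 3 ↔ c < 3 := by
  by_cases h1 : c = β
  · subst h1; simp [hβ, hγ]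
  · by_cases h2 : c = γ
    · subst h2; simp [hβ, hγ]
    · rw [Equiv.swap_apply_of_ne_of_ne h1 h2]

lemma FPswap_lt {f : V → V → ℕ} {K : Set V} {β γ : ℕ} (hβ : β < 3) (hγ : γ < 3) (x y : V) :
    FPswap f K β γ x y < 3 ↔ f x y < 3 := by
  unfold FPswap
  split_ifs
  · exact FP_swap_lt hβ hγ
  · rfl

lemma FPswap_pec {f : V → V → ℕ} (H : FPpec G f) {K : Set V} {β γ : ℕ} (hβ : β < 3) (hγ : γ < 3)
    (hK : ∀ x y, G.Adj x y → (f x y = β ∨ f x y = γ) → x ∈ K → y ∈ K) : FPpec G (FPswap f K β γ) := by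
  refine ⟨fun x y => ?_, fun x y y' h h' hlt e => ?_⟩
  · unfold FPswap
    rw [H.symm y x]
    by_cases hc : x ∈ K ∧ y ∈ K
    · rw [if_pos hc, if_pos hc.symm]
    · rw [if_neg hc, if_neg (fun h => hc h.symm)]
  · rw [FPswap_lt hβ hγ] at hlt
    by_cases hx : x ∈ K
    · rw [FPswap_in H hK h hx, FPswap_in H hK h' hx] at e
      exact H.proper x y y' h h' hlt ((Equiv.swap β γ).injective e)
    · rw [FPswap_out hx, FPswap_out hx] at e
      exact H.proper x y y' h h' hlt e

lemma FPswap_max {f : V → V → ℕ} (H : FPmax G f) {K : Set V} {β γ : ℕ} (hβ : β < 3) (hγ : γ < 3)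
    (hK : ∀ x y, G.Adj x y → (f x y = β ∨ f x y = γ) → x ∈ K → y ∈ K) : FPmax G (FPswap f K β γ) := by
  refine ⟨FPswap_pec H.1 hβ hγ hK, fun g hg => ?_⟩
  have : FPcset G (FPswap f K β γ) = FPcset G f := by
    ext ⟨x, y⟩
    rw [FPcset_mem, FPcset_mem, FPswap_lt hβ hγ]
  rw [this]; exact H.2 g hg

lemma FP_K1 [DecidableRel G.Adj] {f : V → V → ℕ} (H : FPmax G f) (hD : ∀ v, G.degree v ≤ 3) {v u1 u2 : V}
    (h1 : G.Adj v u1) (h2 : G.Adj v u2) (n1 : ¬ f v u1 < 3) (n2 : ¬ f v u2 < 3) : u1 = u2 := by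
  classical
  by_contra hne
  have one : ∀ a b, G.Adj v a → G.Adj v b → f v a < 3 → f v b < 3 → a = b := by
    intro a b ha hb fa fb
    by_contra hab
    have hsub : ({u1, u2, a, b} : Finset V) ⊆ G.neighborFinset v := by
      intro x hx
      simp only [Finset.mem_insert, Finset.mem_singleton] at hx
      rw [mem_neighborFinset]
      rcases hx with rfl | rfl | rfl | rfl <;> assumption
    have := Finset.card_le_card hsub
    rw [card_neighborFinset_eq_degree] at this
    have h4 : ({u1, u2, a, b} : Finset V).card = 4 := by
      rw [Finset.card_eq_of_equiv_fin]
      have q1 : u1 ≠ a := by rintro rfl; exact n1 fa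
      have q2 : u1 ≠ b := by rintro rfl; exact n1 fb
      have q3 : u2 ≠ a := by rintro rfl; exact n2 fa
      have q4 : u2 ≠ b := by rintro rfl; exact n2 fb
      exact Finset.equivFinOfCardEq (by
        rw [Finset.card_insert_of_notMem, Finset.card_insert_of_notMem, Finset.card_pair hab] <;>
        simp [hne, q1, q2, q3, q4])
    have := hD v
    omega
  have n1' : ¬ f u1 v < 3 := by rw [H.1.symm]; exact n1
  have n2' : ¬ f u2 v < 3 := by rw [H.1.symm]; exact n2
  obtain ⟨γ, hγ, m1⟩ := FP_missing hD h1.symm n1'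
  obtain ⟨γ', hγ', m2⟩ := FP_missing hD h2.symm n2'
  obtain ⟨a, ha, ea⟩ : ∃ a, G.Adj v a ∧ f v a = γ := by
    by_contra hc; push Not at hc
    exact FP_K0 H h1 n1 γ hγ hc m1
  obtain ⟨b, hb, eb⟩ : ∃ a, G.Adj v a ∧ f v a = γ' := by
    by_contra hc; push Not at hc
    exact FP_K0 H h2 n2 γ' hγ' hc m2
  have hab := one a b ha hb (by omega) (by omega)
  subst hab
  have hgg : γ' = γ := by omega
  subst hgg
  obtain ⟨β, hβ, hβγ⟩ : ∃ β, β < 3 ∧ β ≠ γ' := by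
    by_cases h : γ' = 0
    · exact ⟨1, by omega, by omega⟩
    · exact ⟨0, by omega, by omega⟩
  have mv : ∀ x, G.Adj v x → f v x ≠ β := by
    intro x hx e
    have := one a x ha hx (by omega) (by omega)
    subst this
    omega
  obtain ⟨K, hvK, hor, hK⟩ := FP_chain H.1 β γ' hβ hγ v u1 u2 mv m1 m2 hne
  have HS := FPswap_max H hβ hγ hK
  have fin : ∀ u, G.Adj v u → ¬ f v u < 3 → (∀ x, G.Adj u x → f u x ≠ γ') → u ∉ K → False := by
    intro u hu nu mu hk
    refine FP_K0 HS hu (by rw [FPswap_lt hβ hγ]; exact nu) γ' hγ ?_ ?_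
    · intro x hx
      rw [FPswap_in H.1 hK hx hvK]
      intro e
      have : f v x = β := by
        rw [Equiv.swap_apply_eq_iff, Equiv.swap_apply_right] at e
        exact e
      exact mv x hx this
    · intro x hx
      rw [FPswap_out hk]
      exact mu x hx
  rcases hor with hk | hk
  · exact fin u1 h1 n1 m1 hk
  · exact fin u2 h2 n2 m2 hk

lemma FP_K2 [DecidableRel G.Adj] {f : V → V → ℕ} (H : FPmax G f) (hD : ∀ v, G.degree v ≤ 3) {v w x y : V}
    (hvw : G.Adj v w) (nvw : ¬ f v w < 3) (hvx : G.Adj v x) (c : ℕ) (hc : c < 3) (e : f v x = c)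
    (mw : ∀ z, G.Adj w z → f w z ≠ c) (hxy : G.Adj x y) : f x y < 3 := by
  by_contra nxy
  have hxw : x ≠ w := by rintro rfl; omega
  have hvy : v ≠ y := by rintro rfl; rw [H.1.symm] at nxy; omega
  have hwy : w ≠ y := by
    rintro rfl
    have := FP_K1 H hD hvw.symm hxy.symm (by rw [H.1.symm]; exact nvw) (by rw [H.1.symm]; exact nxy)
    exact hvx.ne this
  have g1 : FPpec G (FPset f v x 3) := FPset_pec H.1 hvx 3 (fun _ _ h => by omega) (fun _ _ h => by omega)
  have hne1 : ¬ ((v = v ∧ w = x) ∨ (v = x ∧ w = v)) := by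
    rintro (h | h)
    · exact hxw h.2.symm
    · exact hvx.ne h.1
  have g2 : FPpec G (FPset (FPset f v x 3) v w c) := by
    refine FPset_pec g1 hvw c ?_ ?_
    · intro z hz _ _ ez
      by_cases hzx : z = x
      · subst hzx
        rw [FPset_self] at ez; omega
      · rw [FPset_of_ne] at ez
        · exact hzx (H.1.proper v z x hz hvx (by omega) (by omega))
        · rintro (h | h)
          · exact hzx h.2
          · exact hvx.ne h.1
    · intro z hz _ hzv ez
      rw [FPset_of_ne] at ez
      · exact mw z hz ez
      · rintro (h | h)
        · exact hvw.ne h.1.symm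
        · exact hzv h.2
  have c1 : (FPcset G (FPset (FPset f v x 3) v w c)).card = (FPcset G (FPset f v x 3)).card + 2 := by
    apply FPset_card g1.symm hvw c hc
    rw [FPset_of_ne _ _ _ _ hne1]; exact nvw
  have c2 : (FPcset G (FPset (FPset f v x 3) v x c)).card = (FPcset G (FPset f v x 3)).card + 2 := by
    apply FPset_card g1.symm hvx c hc
    rw [FPset_self]; omega
  have c3 : FPset (FPset f v x 3) v x c = f := by
    funext a b
    by_cases h : (a = v ∧ b = x) ∨ (a = x ∧ b = v)
    · rcases h with ⟨rfl, rfl⟩ | ⟨rfl, rfl⟩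
      · rw [FPset_self, e]
      · rw [FPset_self', H.1.symm, e]
    · rw [FPset_of_ne _ _ _ _ h, FPset_of_ne _ _ _ _ h]
  rw [c3] at c2
  have HM : FPmax G (FPset (FPset f v x 3) v w c) := ⟨g2, fun g hg => by
    have := H.2 g hg
    omega⟩
  have := FP_K1 HM hD hvx.symm hxy (by
    rw [FPset_of_ne, FPset_self']
    · omega
    · rintro (h | h)
      · exact hvx.ne h.1.symm
      · exact hxw h.1) (by
    rw [FPset_of_ne, FPset_of_ne]
    · exact nxy
    · rintro (h | h)
      · exact hvx.ne h.1.symm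
      · exact hvy h.2.symm
    · rintro (h | h)
      · exact hvx.ne h.1.symm
      · exact hxw h.1)
  exact hvy this
end FPedge2

lemma FP_bool_one {a b : Bool} (h : a ≠ b) : ((if a = true then 1 else 0 : ℕ) = 1 ↔ (if b = true then 1 else 0 : ℕ) ≠ 1) := by
  cases a <;> cases b <;> simp_all

lemma FP_three {V : Type*} [Fintype V] (G : SimpleGraph V) [DecidableRel G.Adj] (k s : ℕ)
    (hD : ∀ v, G.degree v ≤ 3) (hs : s + 2 ≤ k) : ∃ A L, FPData G k s 3 A L := by
  classical
  obtain ⟨f, H⟩ := FPmax_exists G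
  let N : V → V → Prop := fun v w => G.Adj v w ∧ ¬ f v w < 3
  have Nsymm : ∀ v w, N v w → N w v := fun v w h => ⟨h.1.symm, by rw [H.1.symm]; exact h.2⟩
  have Nuniq : ∀ v w w', N v w → N v w' → w = w' := fun v w w' h h' => FP_K1 H hD h.1 h'.1 h.2 h'.2
  have hmis : ∀ v, ∃ c, (∃ w, N v w) → c < 3 ∧ ∀ x, G.Adj v x → f v x ≠ c := by
    intro v
    by_cases hv : ∃ w, N v w
    · obtain ⟨w, hw⟩ := hv
      obtain ⟨c, hc, h⟩ := FP_missing hD hw.1 hw.2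
      exact ⟨c, fun _ => ⟨hc, h⟩⟩
    · exact ⟨0, fun h => absurd h hv⟩
  choose mis hmis using hmis
  have mis_ne : ∀ v w, N v w → mis v ≠ mis w := by
    intro v w h e
    have h1 := hmis v ⟨w, h⟩
    have h2 := hmis w ⟨v, Nsymm _ _ h⟩
    exact FP_K0 H h.1 h.2 (mis v) h1.1 h1.2 (by rw [e]; exact h2.2)
  let L : V → V → ℕ := fun v w => if f v w < 3 then f v w else mis v
  have Lc : ∀ v w, f v w < 3 → L v w = f v w := fun v w h => by simp only [L, if_pos h]
  have Ln : ∀ v w, ¬ f v w < 3 → L v w = mis v := fun v w h => by simp only [L, if_neg h]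
  have Llt : ∀ v w, G.Adj v w → L v w < 3 := by
    intro v w h
    by_cases hc : f v w < 3
    · rw [Lc v w hc]; exact hc
    · rw [Ln v w hc]; exact (hmis v ⟨w, h, hc⟩).1
  have Linj : ∀ v w w', G.Adj v w → G.Adj v w' → L v w = L v w' → w = w' := by
    intro v w w' h h' e
    by_cases hc : f v w < 3 <;> by_cases hc' : f v w' < 3
    · rw [Lc v w hc, Lc v w' hc'] at e
      exact H.1.proper v w w' h h' hc e
    · rw [Lc v w hc, Ln v w' hc'] at e
      exact absurd e ((hmis v ⟨w', h', hc'⟩).2 w h)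
    · rw [Ln v w hc, Lc v w' hc'] at e
      exact absurd e.symm ((hmis v ⟨w, h, hc⟩).2 w' h')
    · exact Nuniq v w w' ⟨h, hc⟩ ⟨h', hc'⟩
  let Q : V → V → Prop := fun v w => G.Adj v w ∧ f v w < 3 ∧ (∃ x, N v x) ∧ (∃ x, N w x)
  have Quniq : ∀ v w w', Q v w → Q v w' → w = w' := by
    intro v x1 x2 h1 h2
    obtain ⟨a1, b1, ⟨w, hw⟩, ⟨y1, hy1⟩⟩ := h1
    obtain ⟨a2, b2, -, ⟨y2, hy2⟩⟩ := h2
    have m1 := hmis v ⟨w, hw⟩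
    have m2 := hmis w ⟨v, Nsymm _ _ hw⟩
    have k1 : f v x1 ≠ mis w := fun e => hy1.2 (FP_K2 H hD hw.1 hw.2 a1 _ m2.1 e m2.2 hy1.1)
    have k2 : f v x2 ≠ mis w := fun e => hy2.2 (FP_K2 H hD hw.1 hw.2 a2 _ m2.1 e m2.2 hy2.1)
    have k3 := m1.2 x1 a1
    have k4 := m1.2 x2 a2
    have k5 := mis_ne v w hw
    have k6 := m1.1
    have k7 := m2.1
    refine H.1.proper v x1 x2 a1 a2 b1 ?_
    clear * - k1 k2 k3 k4 k5 k6 k7 b1 b2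
    omega
  obtain ⟨hb, hbN, hbQ⟩ := FP_two_match N Q Nsymm
    (fun v w h => ⟨h.1.symm, by rw [H.1.symm]; exact h.2.1, h.2.2.2, h.2.2.1⟩)
    (fun v h => h.1.ne rfl) (fun v h => h.1.ne rfl) Nuniq Quniq
  let hv : V → ℕ := fun v => if (∃ x, N v x) ∧ hb v = true then 1 else 0
  have hv1 : ∀ v, hv v = 1 ↔ (∃ x, N v x) ∧ hb v = true := by
    intro v; simp only [hv]; split_ifs with c <;> simp [c]
  have hvNN : ∀ v w, G.Adj v w → (∃ x, N v x) → (∃ x, N w x) → (hv v = 1 ↔ hv w ≠ 1) := by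
    intro v w h h1 h2
    have hne : hb v ≠ hb w := by
      by_cases hc : f v w < 3
      · exact hbQ v w ⟨h, hc, h1, h2⟩
      · exact hbN v w ⟨h, hc⟩
    rw [Ne, hv1, hv1]
    simp only [h1, h2, true_and]
    revert hne
    generalize hb v = x
    generalize hb w = y
    cases x <;> cases y <;> simp
  have hvboth : ∀ v w, G.Adj v w → ¬ (hv v = 1 ∧ hv w = 1) := by
    rintro v w h ⟨h1, h2⟩
    exact ((hvNN v w h ((hv1 v).1 h1).1 ((hv1 w).1 h2).1).1 h1) h2
  -- orientations
  have hob : ∀ l, ∃ b : V → Bool, l < 3 → (∀ v w, G.Adj v w → f v w = l → b v ≠ b w) ∧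
      (∀ v w, (N v w ∨ (G.Adj v w ∧ f v w = (l + 1) % 3 ∧ (¬ ∃ x, N v x) ∧ ¬ ∃ x, N w x)) → b v ≠ b w) := by
    intro l
    by_cases hl : l < 3
    · obtain ⟨b, b1, b2⟩ := FP_two_match (fun v w => G.Adj v w ∧ f v w = l)
        (fun v w => N v w ∨ (G.Adj v w ∧ f v w = (l + 1) % 3 ∧ (¬ ∃ x, N v x) ∧ ¬ ∃ x, N w x))
        (fun v w h => ⟨h.1.symm, by rw [H.1.symm]; exact h.2⟩)
        (fun v w h => h.elim (fun h => Or.inl (Nsymm _ _ h)) (fun h => Or.inr ⟨h.1.symm, by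
          rw [H.1.symm]; exact h.2.1, h.2.2.2, h.2.2.1⟩))
        (fun v h => h.1.ne rfl) (fun v h => h.elim (fun h => h.1.ne rfl) (fun h => h.1.ne rfl))
        (fun v w w' h h' => H.1.proper v w w' h.1 h'.1 (by rw [h.2]; exact hl) (by rw [h.2, h'.2]))
        (by
          rintro v w w' (h | h) (h' | h')
          · exact Nuniq v w w' h h'
          · exact absurd ⟨w, h⟩ h'.2.2.1
          · exact absurd ⟨w', h'⟩ h.2.2.1
          · exact H.1.proper v w w' h.1 h'.1 (by rw [h.2.1]; exact Nat.mod_lt _ (by norm_num)) (by rw [h.2.1, h'.2.1]))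
      exact ⟨b, fun _ => ⟨fun v w h e => b1 v w ⟨h, e⟩, b2⟩⟩
    · exact ⟨fun _ => true, fun h => absurd h hl⟩
  choose ob hob using hob
  let o : V → ℕ → ℕ := fun v l => if ob l v = true then 1 else 0
  have oMut : ∀ v w, G.Adj v w → f v w < 3 → (o v (f v w) = 1 ↔ o w (f v w) ≠ 1) :=
    fun v w h hc => FP_bool_one ((hob _ hc).1 v w h rfl)
  have oN : ∀ v w, N v w → ∀ l < 3, (o v l = 1 ↔ o w l ≠ 1) :=
    fun v w h l hl => FP_bool_one ((hob l hl).2 v w (Or.inl h))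
  have oFar : ∀ v w, G.Adj v w → f v w < 3 → (¬ ∃ x, N v x) → (¬ ∃ x, N w x) →
      ∃ d < 3, d ≠ f v w ∧ (o v d = 1 ↔ o w d ≠ 1) := by
    intro v w h hc h1 h2
    refine ⟨(f v w + 2) % 3, Nat.mod_lt _ (by norm_num), by omega, ?_⟩
    exact FP_bool_one ((hob _ (Nat.mod_lt _ (by norm_num))).2 v w (Or.inr ⟨h, by omega, h1, h2⟩))
  -- end colours
  have hp : ∀ v, ∃ w, (∃ x, N v x) → N v w := by
    intro v
    by_cases h : ∃ x, N v x
    · obtain ⟨x, hx⟩ := h; exact ⟨x, fun _ => hx⟩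
    · exact ⟨v, fun h' => absurd h' h⟩
  choose p hp using hp
  have pm : ∀ v, (∃ x, N v x) → mis (p v) < 3 := fun v h => (hmis (p v) ⟨v, Nsymm _ _ (hp v h)⟩).1
  obtain ⟨τ, t1, t2, t3⟩ := FP_greedy G 3 hD {v | ∃ x, N v x} (fun v => if hv v = 1 then mis (p v) else 3)
    (by
      intro v h
      split_ifs
      · exact (pm v h).le
      · exact le_rfl)
    (by
      intro v h w h' hvw
      have h1 := hvNN v w hvw h h'
      have h2 := pm v h
      have h3 := pm w h'
      split_ifs with c1 c2 c2
      · exact absurd c2 (h1.1 c1)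
      · omega
      · omega
      · exact absurd (h1.2 c2) c1)
  have tH : ∀ v w, N v w → hv v = 1 → τ v = mis w := by
    intro v w h h1
    rw [t1 v ⟨w, h⟩, if_pos h1, Nuniq v _ _ (hp v ⟨w, h⟩) h]
  have tL : ∀ v, (∃ x, N v x) → hv v ≠ 1 → τ v = 3 := by
    intro v h h1
    rw [t1 v h, if_neg h1]
  have hh : ∀ v, hv v = 1 → τ v ≠ 3 := by
    intro v h
    have hx := ((hv1 v).1 h).1
    rw [tH v _ (hp v hx) h]
    exact (pm v hx).ne
  refine ⟨fun v => FPstar k s (hv v) (τ v) (o v), L, hs, Llt, Linj, ?_, ?_, ?_, ?_, ?_⟩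
  · intro v l l' i i' a1 a2 a3 a4 e
    exact FPstar_S k s hs _ _ _ (hh v) l l' i i' a1 a2 a3 a4 e
  · intro v l l'
    simp [FPstar]
  · intro v l i hl hi
    exact FPstar_range k s hs _ _ (t2 v) _ l i hl hi
  · intro v w i j h hi hj e
    by_cases hc : f v w < 3
    · have hc' : f w v < 3 := by rw [H.1.symm]; exact hc
      rw [Lc v w hc, Lc w v hc', H.1.symm w v] at e
      exact FPstar_E_mut k s hs _ _ _ _ _ _ (hh v) (hh w) (hvboth v w h) (t3 v w h) _ i j hc hi hj (oMut v w h hc) e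
    · have hN : N v w := ⟨h, hc⟩
      have hN' := Nsymm _ _ hN
      rw [Ln v w hc, Ln w v hN'.2] at e
      have mv := (hmis v ⟨w, hN⟩).1
      have mw := (hmis w ⟨v, hN'⟩).1
      have hx := hvNN v w h ⟨w, hN⟩ ⟨v, hN'⟩
      by_cases c : hv v = 1
      · have c' := hx.1 c
        rw [tH v w hN c, tL w ⟨v, hN'⟩ c'] at e
        exact FPstar_E_N k s hs _ _ _ _ _ _ c c' (mis_ne v w hN) i j mv mw hi hj (oN v w hN) e
      · have c' : hv w = 1 := by
          by_contra hcc
          exact c (hx.2 hcc)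
        rw [tH w v hN' c', tL v ⟨w, hN⟩ c] at e
        have := FPstar_E_N k s hs _ _ _ _ _ _ c' c (mis_ne w v hN') j i mw mv hj hi (oN w v hN') e.symm
        omega
  · intro v w h
    by_cases hc : f v w < 3
    · have hc' : f w v < 3 := by rw [H.1.symm]; exact hc
      rw [Lc v w hc, Lc w v hc', H.1.symm w v]
      refine FPMut_fill_all k s _ _ _ _ _ _ _ hs (hh v) (hh w) (hvboth v w h) (t3 v w h) hc (t2 v) (t2 w)
        (oMut v w h hc) ?_
      intro q1 q2 q3 q4
      exact oFar v w h hc (fun hx => q3 (tL v hx q1)) (fun hx => q4 (tL w hx q2))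
    · have hN : N v w := ⟨h, hc⟩
      have hN' := Nsymm _ _ hN
      rw [Ln v w hc, Ln w v hN'.2]
      have mv := (hmis v ⟨w, hN⟩).1
      have mw := (hmis w ⟨v, hN'⟩).1
      have hx := hvNN v w h ⟨w, hN⟩ ⟨v, hN'⟩
      have hne := mis_ne v w hN
      obtain ⟨d, d1, d2, d3⟩ : ∃ d < 3, d ≠ mis v ∧ d ≠ mis w := by
        by_cases e0 : mis v ≠ 0 ∧ mis w ≠ 0
        · exact ⟨0, by omega, by omega, by omega⟩
        · by_cases e1 : mis v ≠ 1 ∧ mis w ≠ 1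
          · exact ⟨1, by omega, by omega, by omega⟩
          · exact ⟨2, by omega, by omega, by omega⟩
      by_cases c : hv v = 1
      · have c' := hx.1 c
        rw [tH v w hN c, tL w ⟨v, hN'⟩ c', c]
        exact ⟨_, FPN_fill k s _ _ _ d _ _ hs c' mv mw d1 hne d3 d2 (oN v w hN)⟩
      · have c' : hv w = 1 := by
          by_contra hcc
          exact c (hx.2 hcc)
        rw [tH w v hN' c', tL v ⟨w, hN⟩ c, c']
        exact ⟨_, (FPN_fill k s _ _ _ d _ _ hs c mw mv d1 hne.symm d2 d3 (oN w v hN')).flip⟩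

theorem chromatic_eq_clique_of_odd_second_range {V : Type*} [Fintype V] (G : SimpleGraph V)
    [DecidableRel G.Adj] (hnc : G ≠ ⊤) (hΔ : 3 ≤ G.maxDegree)
    (m n : ℕ) (hm : Odd m) (hm3 : 3 ≤ m) (hn1 : 3 * m + 5 ≤ 2 * n) (hn2 : n ≤ 2 * m) :
    (fracPower G m n).chromaticNumber = (fracPower G m n).cliqueNum := by
  obtain ⟨k, rfl⟩ := hm
  obtain ⟨s, rfl⟩ : ∃ s, n = 3 * k + 4 + s := ⟨n - (3 * k + 4), by omega⟩
  have hs : s + 2 ≤ k := by omega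
  obtain ⟨ord, hord⟩ := Countable.exists_injective_nat V
  have hD : ∀ v, G.degree v ≤ G.maxDegree := G.degree_le_maxDegree
  have hdata : ∃ A L, FPData G k s G.maxDegree A L := by
    by_cases h3 : G.maxDegree = 3
    · rw [h3]
      rw [h3] at hD
      exact FP_three G k s hD hs
    · exact FP_big G k s _ hD (by omega) hs ord hord
  obtain ⟨A, L, H⟩ := hdata
  have hcol := FP_colorable H (by omega) ord hord
  have hcl := FP_clique G k (3 * k + 4 + s) _ rfl hΔ (by omega)
  have := FP_finite G (3 * k + 4 + s)
  refine le_antisymm ?_ cliqueNum_le_chromaticNumber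
  refine hcol.chromaticNumber_le.trans ?_
  exact_mod_cast hcl
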